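/- arXiv:2110.08775 — 5 statements merged into one kernel-verified Lean document; each statement's English description precedes it below -/
import Mathlib

section
/- Let ρ : ℝ → ℝ be a nonnegative, continuously differentiable, compactly supported probability density, and suppose h : ℝ → ℝ satisfies, for every x ∈ ℝ, h(x) = lim_{ε→0⁺} (1/π) ∫_{{y : |x−y|>ε}} ρ(y)/(x−y) dy (i.e. h is the Hilbert transform of ρ). Then (1/3) ∫_ℝ ρ(x)³ dx = ∫_ℝ ρ(x) h(x)² dx. -/
open MeasureTheory Real Filter Set

lemma ht_int_mul (ρ : ℝ → ℝ) (hc : Continuous ρ) (hs : HasCompactSupport ρ) (k : ℝ → ℝ)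
    (hk : Measurable k) (C : ℝ) (hb : ∀ t, |k t| ≤ C) : Integrable (fun t => ρ t * k t) := by
  have h1 : Integrable ρ := hc.integrable_of_hasCompactSupport hs
  exact h1.mul_bdd (c := C) hk.aestronglyMeasurable (ae_of_all _ hb)

/-- symmetrization -/
lemma ht_sym (ρ : ℝ → ℝ) (hc : Continuous ρ) (hs : HasCompactSupport ρ) (k : ℝ → ℝ)
    (hk : Measurable k) (C : ℝ) (hb : ∀ t, |k t| ≤ C) (hodd : ∀ t, k (-t) = - k t) (x : ℝ) :
    ∫ y, ρ y * k (x - y) = (1/2) * ∫ t, (ρ (x - t) - ρ (x + t)) * k t := by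
  have e1 : ∫ y, ρ y * k (x - y) = ∫ t, ρ (x - t) * k t := by
    rw [← integral_sub_left_eq_self _ volume x]
    simp
  have i0 : Integrable (fun y => ρ y * k (x - y)) :=
    ht_int_mul ρ hc hs (fun y => k (x - y)) (by fun_prop) C (fun t => hb _)
  have i1 : Integrable (fun t => ρ (x - t) * k t) := by
    have := i0.comp_sub_left x
    simpa using this
  have i2 : Integrable (fun t => ρ (x + t) * k t) := by
    have := i1.comp_neg.neg
    refine this.congr (ae_of_all _ fun t => ?_)
    simp [hodd]
  have e2 : ∫ t, ρ (x + t) * k t = - ∫ t, ρ (x - t) * k t := by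
    rw [← integral_neg_eq_self, ← integral_neg]
    congr 1; ext t
    simp [hodd, sub_eq_add_neg]
  rw [e1]
  have : ∫ t, (ρ (x - t) - ρ (x + t)) * k t = ∫ t, ρ (x - t) * k t - ρ (x + t) * k t := by
    congr 1; ext t; ring
  rw [this, integral_sub i1 i2, e2]
  ring

/-- pointwise bound -/
lemma ht_ptbound (ρ : ℝ → ℝ) (L : NNReal) (hL : LipschitzWith L ρ) (M : ℝ)
    (hM : ∀ y, M < |y| → ρ y = 0) (R x : ℝ) (hx : |x| ≤ R) (t q : ℝ) (hq : |q| ≤ 1 / |t|) :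
    ‖(ρ (x - t) - ρ (x + t)) * q‖ ≤ (Icc (-(R + M)) (R + M)).indicator (fun _ => 2 * (L:ℝ)) t := by
  by_cases ht : t ∈ Icc (-(R + M)) (R + M)
  · rw [indicator_of_mem ht, norm_mul]
    have h1 := hL.dist_le_mul (x - t) (x + t)
    rw [dist_eq_norm, Real.dist_eq, show x - t - (x + t) = -(2 * t) by ring, abs_neg, abs_mul,
      abs_two] at h1
    rcases eq_or_ne t 0 with rfl | h0
    · simp
    have h2 : 0 < |t| := abs_pos.2 h0
    calc _ ≤ (L * (2 * |t|)) * (1 / |t|) := by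
            refine mul_le_mul h1 hq (norm_nonneg _) (by positivity)
      _ = 2 * L := by field_simp
  · rw [indicator_of_notMem ht]
    have h3 : R + M < |t| := by
      by_contra hcon
      exact ht (abs_le.1 (not_lt.1 hcon))
    have h4 : |t| ≤ |x - t| + |x| := by
      have := abs_sub_abs_le_abs_sub t x
      rw [abs_sub_comm] at this; linarith
    have h5 : |t| ≤ |x + t| + |x| := by
      have := abs_sub (x + t) x
      simpa using this
    rw [hM (x - t) (by linarith), hM (x + t) (by linarith)]
    simp

lemma ht_bound (ρ : ℝ → ℝ) (hc : Continuous ρ) (hs : HasCompactSupport ρ) (k : ℝ → ℝ)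
    (hk : Measurable k) (C : ℝ) (hb : ∀ t, |k t| ≤ C) (hodd : ∀ t, k (-t) = - k t)
    (hk1 : ∀ t, |k t| ≤ 1 / |t|)
    (L : NNReal) (hL : LipschitzWith L ρ) (M : ℝ)
    (hM : ∀ y, M < |y| → ρ y = 0) (R x : ℝ) (hx : |x| ≤ R) :
    |∫ y, ρ y * k (x - y)| ≤ ∫ t, (Icc (-(R + M)) (R + M)).indicator (fun _ => 2 * (L:ℝ)) t := by
  rw [ht_sym ρ hc hs k hk C hb hodd x]
  have hi : Integrable ((Icc (-(R + M)) (R + M)).indicator (fun _ => 2 * (L:ℝ))) := by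
    rw [integrable_indicator_iff measurableSet_Icc]
    exact integrableOn_const (by simp)
  have := norm_integral_le_of_norm_le hi
    (ae_of_all _ fun t => ht_ptbound ρ L hL M hM R x hx t (k t) (hk1 t))
  rw [abs_mul, abs_of_pos (by norm_num : (0:ℝ) < 1/2)]
  rw [Real.norm_eq_abs] at this
  have h0 := abs_nonneg (∫ t, (ρ (x - t) - ρ (x + t)) * k t)
  linarith

lemma ht_tendsto (ρ : ℝ → ℝ) (hc : Continuous ρ) (hs : HasCompactSupport ρ) (k : ℝ → ℝ → ℝ)
    (hk : ∀ ε > 0, Measurable (k ε)) (hb : ∀ ε > 0, ∀ t, |k ε t| ≤ 1 / ε)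
    (hodd : ∀ ε t, k ε (-t) = - k ε t)
    (hk1 : ∀ ε > 0, ∀ t, |k ε t| ≤ 1 / |t|)
    (hlim : ∀ t ≠ 0, Tendsto (fun ε => k ε t) (nhdsWithin 0 (Ioi 0)) (nhds (1 / t)))
    (L : NNReal) (hL : LipschitzWith L ρ) (M : ℝ)
    (hM : ∀ y, M < |y| → ρ y = 0) (x : ℝ) :
    Tendsto (fun ε => ∫ y, ρ y * k ε (x - y)) (nhdsWithin 0 (Ioi 0))
      (nhds ((1/2) * ∫ t, (ρ (x - t) - ρ (x + t)) * (1 / t))) := by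
  have hi : Integrable ((Icc (-(|x| + M)) (|x| + M)).indicator (fun _ => 2 * (L:ℝ))) := by
    rw [integrable_indicator_iff measurableSet_Icc]
    exact integrableOn_const (by simp)
  have key : Tendsto (fun ε => ∫ t, (ρ (x - t) - ρ (x + t)) * k ε t) (nhdsWithin 0 (Ioi 0))
      (nhds (∫ t, (ρ (x - t) - ρ (x + t)) * (1 / t))) := by
    refine tendsto_integral_filter_of_dominated_convergence _ ?_ ?_ hi ?_
    · filter_upwards [self_mem_nhdsWithin] with ε hε
      have := hk ε hε
      have h2 := hc.measurable
      exact (by fun_prop : Measurable fun t => (ρ (x - t) - ρ (x + t)) * k ε t).aestronglyMeasurable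
    · filter_upwards [self_mem_nhdsWithin] with ε hε
      exact ae_of_all _ fun t => ht_ptbound ρ L hL M hM |x| x le_rfl t (k ε t) (hk1 ε hε t)
    · have : ∀ᵐ t : ℝ, t ≠ 0 := by simp [ae_iff]
      filter_upwards [this] with t ht
      exact (hlim t ht).const_mul _
  refine (key.const_mul (1/2)).congr' ?_
  filter_upwards [self_mem_nhdsWithin] with ε hε
  exact (ht_sym ρ hc hs (k ε) (hk ε hε) _ (hb ε hε) (hodd ε) x).symm

/-- kernel 1 -/
lemma ht_k1_bound (ε t : ℝ) (hε : 0 < ε) : |t / (t ^ 2 + ε ^ 2)| ≤ 1 / ε := by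
  have h : 0 < t ^ 2 + ε ^ 2 := by positivity
  rw [abs_div, abs_of_pos h, div_le_div_iff₀ h hε, ← sq_abs t]
  nlinarith [sq_nonneg (|t| - ε), sq_nonneg |t|, sq_nonneg ε, abs_nonneg t]

lemma ht_k1_bound2 (ε t : ℝ) (hε : 0 < ε) : |t / (t ^ 2 + ε ^ 2)| ≤ 1 / |t| := by
  rcases eq_or_ne t 0 with rfl | h0
  · simp
  have h : 0 < t ^ 2 + ε ^ 2 := by positivity
  have h2 : 0 < |t| := abs_pos.2 h0
  rw [abs_div, abs_of_pos h, div_le_div_iff₀ h h2, ← sq_abs t]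
  nlinarith [sq_nonneg ε]

lemma ht_k1_lim (t : ℝ) (ht : t ≠ 0) :
    Tendsto (fun ε : ℝ => t / (t ^ 2 + ε ^ 2)) (nhdsWithin 0 (Ioi 0)) (nhds (1 / t)) := by
  have : ContinuousAt (fun ε : ℝ => t / (t ^ 2 + ε ^ 2)) 0 := by
    refine ContinuousAt.div (by fun_prop) (by fun_prop) (by positivity)
  have h2 := this.tendsto.mono_left (nhdsWithin_le_nhds (s := Ioi 0))
  convert h2 using 2
  field_simp
  simp

noncomputable def htF (ρ : ℝ → ℝ) (z : ℂ) : ℂ := ∫ y : ℝ, (ρ y : ℂ) / (z - y)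

lemma ht_im_le (z : ℂ) (y : ℝ) : z.im ≤ ‖z - y‖ := by
  have := Complex.abs_im_le_norm (z - y)
  simp at this
  exact (le_abs_self _).trans this

lemma ht_F_meas (ρ : ℝ → ℝ) (hc : Continuous ρ) (z : ℂ) :
    AEStronglyMeasurable (fun y : ℝ => (ρ y : ℂ) / (z - y)) volume := by
  have := hc.measurable
  exact (by fun_prop : Measurable fun y : ℝ => (ρ y : ℂ) / (z - y)).aestronglyMeasurable

lemma ht_F_int (ρ : ℝ → ℝ) (hc : Continuous ρ) (hs : HasCompactSupport ρ) (z : ℂ)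
    (hz : 0 < z.im) : Integrable (fun y : ℝ => (ρ y : ℂ) / (z - y)) := by
  have h1 : Integrable ρ := hc.integrable_of_hasCompactSupport hs
  refine (h1.norm.mul_const (1 / z.im)).mono' (ht_F_meas ρ hc z) (ae_of_all _ fun y => ?_)
  rw [norm_div, Complex.norm_real, div_eq_mul_one_div]
  gcongr
  exact ht_im_le z y

lemma ht_F_bound (ρ : ℝ → ℝ) (hn : ∀ x, 0 ≤ ρ x) (hc : Continuous ρ) (hs : HasCompactSupport ρ)
    (hp : ∫ x, ρ x = 1) (z : ℂ) (D : ℝ) (hD : 0 < D) (hz : ∀ y, ρ y ≠ 0 → D ≤ ‖z - y‖) :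
    ‖htF ρ z‖ ≤ 1 / D := by
  have h1 : Integrable ρ := hc.integrable_of_hasCompactSupport hs
  have := norm_integral_le_of_norm_le (f := fun y : ℝ => (ρ y : ℂ) / (z - y))
    (h1.mul_const (1 / D)) (ae_of_all _ fun y => by
      rcases eq_or_ne (ρ y) 0 with h | h
      · simp [h]
      rw [norm_div, Complex.norm_real, div_eq_mul_one_div, Real.norm_of_nonneg (hn y)]
      have := hz y h
      have := hn y
      gcongr)
  rw [integral_mul_const, hp, one_mul] at this
  exact this

lemma ht_F_diff (ρ : ℝ → ℝ) (hc : Continuous ρ) (hs : HasCompactSupport ρ) (z : ℂ)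
    (hz : 0 < z.im) : DifferentiableAt ℂ (htF ρ) z := by
  have h1 : Integrable ρ := hc.integrable_of_hasCompactSupport hs
  have him : ∀ w ∈ Metric.ball z (z.im / 2), z.im / 2 ≤ w.im := by
    intro w hw
    have h2 := Complex.abs_im_le_norm (z - w)
    rw [mem_ball_iff_norm'] at hw
    have h3 := le_abs_self (z - w).im
    rw [Complex.sub_im] at h3 h2
    linarith
  have hne : ∀ w ∈ Metric.ball z (z.im / 2), ∀ y : ℝ, 0 < ‖w - y‖ := fun w hw y =>
    lt_of_lt_of_le (by linarith [him w hw]) (ht_im_le w y)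
  have := hasDerivAt_integral_of_dominated_loc_of_deriv_le (μ := volume)
    (F := fun (w : ℂ) (y : ℝ) => (ρ y : ℂ) / (w - y))
    (F' := fun (w : ℂ) (y : ℝ) => -(ρ y : ℂ) / (w - y) ^ 2) (x₀ := z)
    (s := Metric.ball z (z.im / 2)) (bound := fun y => ‖ρ y‖ * (1 / (z.im / 2) ^ 2))
    (Metric.ball_mem_nhds z (by linarith)) (Eventually.of_forall fun w => ht_F_meas ρ hc w)
    (ht_F_int ρ hc hs z hz) ?_ ?_ (h1.norm.mul_const _) ?_
  · exact this.2.differentiableAt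
  · have := hc.measurable
    exact (by fun_prop : Measurable fun y : ℝ => -(ρ y : ℂ) / (z - y) ^ 2).aestronglyMeasurable
  · refine ae_of_all _ fun y w hw => ?_
    rw [norm_div, norm_neg, Complex.norm_real, norm_pow, div_eq_mul_one_div]
    gcongr
    exact (him w hw).trans (ht_im_le w y)
  · refine ae_of_all _ fun y w hw => ?_
    have hn0 : w - (y:ℂ) ≠ 0 := norm_pos_iff.1 (hne w hw y)
    have := ((hasDerivAt_id w).sub_const (y:ℂ)).inv hn0
    have := this.const_mul (ρ y : ℂ)
    refine (this.congr_deriv ?_)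
    simp only [id]
    ring

lemma ht_contour (ρ : ℝ → ℝ) (hn : ∀ x, 0 ≤ ρ x) (hc : Continuous ρ) (hs : HasCompactSupport ρ)
    (hp : ∫ x, ρ x = 1) (M : ℝ) (hM : ∀ y, M < |y| → ρ y = 0) (R : ℝ) (hR0 : 0 < R)
    (hR : 2 * M ≤ R) (ε : ℝ) (hε : 0 < ε) :
    ‖∫ x in (-R)..R, (htF ρ (x + ε * Complex.I)) ^ 3‖ ≤ 18 / R ^ 2 := by
  have hd : DifferentiableOn ℂ (fun z => (htF ρ z) ^ 3)
      (uIcc (-R) R ×ℂ uIcc ε (ε + R)) := by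
    intro z hz
    have h1 := hz.2
    simp only [mem_preimage] at h1
    rw [uIcc_of_le (by linarith)] at h1
    exact ((ht_F_diff ρ hc hs z (by linarith [h1.1])).pow 3).differentiableWithinAt
  have key := Complex.integral_boundary_rect_eq_zero_of_differentiableOn
    (fun z => (htF ρ z) ^ 3) (-R + ε * Complex.I) (R + (ε + R) * Complex.I) (by simpa using hd)
  simp at key
  have top : ‖∫ x in (-R)..R, (htF ρ (x + (ε + R) * Complex.I)) ^ 3‖ ≤ (1 / R) ^ 3 * |R - (-R)| := by
    refine intervalIntegral.norm_integral_le_of_norm_le_const fun x _ => ?_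
    rw [norm_pow]
    gcongr
    refine ht_F_bound ρ hn hc hs hp _ R hR0 fun y _ => le_trans ?_ (ht_im_le _ y)
    simp; linarith
  have side : ∀ a : ℝ, |a| = R → ‖∫ y in ε..(ε + R), (htF ρ (a + y * Complex.I)) ^ 3‖
      ≤ (1 / (R / 2)) ^ 3 * |ε + R - ε| := by
    intro a ha
    refine intervalIntegral.norm_integral_le_of_norm_le_const fun x _ => ?_
    rw [norm_pow]
    gcongr
    refine ht_F_bound ρ hn hc hs hp _ (R / 2) (by positivity) fun y hy => ?_
    have hy2 : |y| ≤ M := by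
      by_contra hcon
      exact hy (hM y (not_le.1 hcon))
    have h1 := Complex.abs_re_le_norm (a + x * Complex.I - y)
    simp at h1
    have h2 := abs_sub_abs_le_abs_sub a y
    linarith
  have sR := side R (abs_of_pos hR0)
  have sL := side (-R) (by rw [abs_neg, abs_of_pos hR0])
  push_cast at sL
  set A := ∫ x in (-R)..R, (htF ρ (x + ε * Complex.I)) ^ 3
  set B := ∫ x in (-R)..R, (htF ρ (x + (ε + R) * Complex.I)) ^ 3
  set P := ∫ y in ε..(ε + R), (htF ρ (R + y * Complex.I)) ^ 3
  set Q := ∫ y in ε..(ε + R), (htF ρ (-R + y * Complex.I)) ^ 3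
  have hA : A = B - Complex.I * P + Complex.I * Q := by linear_combination key
  have e1 : |R - -R| = 2 * R := by rw [abs_of_pos] <;> linarith
  have e2 : |ε + R - ε| = R := by rw [abs_of_pos] <;> linarith
  rw [e1] at top
  rw [e2] at sR sL
  calc ‖A‖ ≤ ‖B‖ + ‖P‖ + ‖Q‖ := by
        rw [hA]
        refine (norm_add_le _ _).trans ?_
        have := norm_sub_le B (Complex.I * P)
        simp only [norm_mul, Complex.norm_I, one_mul] at this ⊢
        linarith
    _ ≤ (1 / R) ^ 3 * (2 * R) + (1 / (R / 2)) ^ 3 * R + (1 / (R / 2)) ^ 3 * R := by linarith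
    _ = 18 / R ^ 2 := by field_simp; norm_num

lemma ht_F_re (ρ : ℝ → ℝ) (hc : Continuous ρ) (hs : HasCompactSupport ρ) (x ε : ℝ) (hε : 0 < ε) :
    (htF ρ (x + ε * Complex.I)).re = ∫ y, ρ y * ((x - y) / ((x - y) ^ 2 + ε ^ 2)) := by
  have hi := ht_F_int ρ hc hs (x + ε * Complex.I) (by simpa using hε)
  have := integral_re hi
  simp only [RCLike.re_eq_complex_re] at this
  rw [htF, ← this]
  congr 1; ext y
  rw [Complex.div_re]
  simp [Complex.normSq_apply]
  ring

lemma ht_F_im (ρ : ℝ → ℝ) (hc : Continuous ρ) (hs : HasCompactSupport ρ) (x ε : ℝ) (hε : 0 < ε) :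
    (htF ρ (x + ε * Complex.I)).im = - ∫ s, ρ (x - ε * s) * (1 + s ^ 2)⁻¹ := by
  have hi := ht_F_int ρ hc hs (x + ε * Complex.I) (by simpa using hε)
  have := integral_im hi
  simp only [RCLike.im_eq_complex_im] at this
  rw [htF, ← this, ← integral_neg]
  rw [← integral_sub_left_eq_self _ volume x]
  have h2 := Measure.integral_comp_mul_left (fun t : ℝ =>
    ((ρ (x - t) : ℂ) / ((x + ε * Complex.I) - ((x - t : ℝ) : ℂ))).im) ε
  rw [abs_of_pos (inv_pos.2 hε), smul_eq_mul, inv_mul_eq_div, eq_div_iff hε.ne'] at h2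
  rw [← h2, ← integral_mul_const]
  congr 1; ext s
  rw [Complex.div_im]
  have : 0 < 1 + s ^ 2 := by positivity
  simp [Complex.normSq_apply]
  have h3 : ε * s * (ε * s) + ε * ε = ε ^ 2 * (1 + s ^ 2) := by ring
  rw [h3]
  field_simp

lemma ht_F_im_bound (ρ : ℝ → ℝ) (hc : Continuous ρ) (hs : HasCompactSupport ρ) (B : ℝ)
    (hB : ∀ x, ‖ρ x‖ ≤ B) (x ε : ℝ) (hε : 0 < ε) :
    |(htF ρ (x + ε * Complex.I)).im| ≤ B * π := by
  rw [ht_F_im ρ hc hs x ε hε, abs_neg]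
  have := norm_integral_le_of_norm_le (f := fun s => ρ (x - ε * s) * (1 + s ^ 2)⁻¹)
    (integrable_inv_one_add_sq.const_mul B) (ae_of_all _ fun s => by
      have : 0 < 1 + s ^ 2 := by positivity
      rw [norm_mul, norm_inv, Real.norm_of_nonneg this.le]
      gcongr
      exact hB _)
  rwa [integral_const_mul, integral_univ_inv_one_add_sq] at this

lemma ht_F_im_lim (ρ : ℝ → ℝ) (hc : Continuous ρ) (hs : HasCompactSupport ρ) (B : ℝ)
    (hB : ∀ x, ‖ρ x‖ ≤ B) (x : ℝ) :
    Tendsto (fun ε : ℝ => (htF ρ (x + ε * Complex.I)).im) (nhdsWithin 0 (Ioi 0))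
      (nhds (- (π * ρ x))) := by
  have key : Tendsto (fun ε : ℝ => ∫ s, ρ (x - ε * s) * (1 + s ^ 2)⁻¹) (nhdsWithin 0 (Ioi 0))
      (nhds (∫ s, ρ x * (1 + s ^ 2)⁻¹)) := by
    refine tendsto_integral_filter_of_dominated_convergence _ ?_ ?_
      (integrable_inv_one_add_sq.const_mul B) ?_
    · refine Eventually.of_forall fun ε => ?_
      have := hc.measurable
      exact (by fun_prop : Measurable fun s => ρ (x - ε * s) * (1 + s ^ 2)⁻¹).aestronglyMeasurable
    · refine Eventually.of_forall fun ε => ae_of_all _ fun s => ?_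
      have : 0 < 1 + s ^ 2 := by positivity
      rw [norm_mul, norm_inv, Real.norm_of_nonneg this.le]
      gcongr
      exact hB _
    · refine ae_of_all _ fun s => ?_
      have : Continuous fun ε : ℝ => ρ (x - ε * s) * (1 + s ^ 2)⁻¹ := by fun_prop
      have := (this.tendsto 0).mono_left (nhdsWithin_le_nhds (s := Ioi 0))
      simpa using this
  rw [integral_const_mul, integral_univ_inv_one_add_sq, mul_comm] at key
  refine key.neg.congr' ?_
  filter_upwards [self_mem_nhdsWithin] with ε hε
  exact (ht_F_im ρ hc hs x ε hε).symm

lemma ht_h_eq (ρ : ℝ → ℝ) (hc : Continuous ρ) (hs : HasCompactSupport ρ)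
    (L : NNReal) (hL : LipschitzWith L ρ) (M : ℝ)
    (hM : ∀ y, M < |y| → ρ y = 0) (x : ℝ) :
    Tendsto (fun ε : ℝ => ∫ y in {y : ℝ | ε < |x - y|}, ρ y / (x - y)) (nhdsWithin 0 (Ioi 0))
      (nhds ((1/2) * ∫ t, (ρ (x - t) - ρ (x + t)) * (1 / t))) := by
  have := ht_tendsto ρ hc hs (fun ε t => if ε < |t| then 1 / t else 0) ?_ ?_ ?_ ?_ ?_ L hL M hM x
  · refine this.congr fun ε => ?_
    have hm : MeasurableSet {y : ℝ | ε < |x - y|} :=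
      measurableSet_lt (by fun_prop) (by fun_prop)
    rw [← integral_indicator hm]
    congr 1; ext y
    by_cases hy : ε < |x - y|
    · rw [indicator_of_mem (s := {y : ℝ | ε < |x - y|}) hy, if_pos hy]; ring
    · rw [indicator_of_notMem (s := {y : ℝ | ε < |x - y|}) hy, if_neg hy, mul_zero]
  · intro ε hε
    exact Measurable.ite (measurableSet_lt (by fun_prop) (by fun_prop)) (by fun_prop) (by fun_prop)
  · intro ε hε t
    split_ifs with h
    · rw [abs_div, abs_one]; gcongr
    · simp; exact (le_of_lt hε)
  · intro ε t
    simp only [abs_neg]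
    split_ifs with h
    · ring
    · simp
  · intro ε hε t
    split_ifs with h
    · rw [abs_div, abs_one]
    · simp
  · intro t ht
    refine tendsto_const_nhds.congr' ?_
    have : ∀ᶠ ε in nhdsWithin (0:ℝ) (Ioi 0), ε < |t| :=
      nhdsWithin_le_nhds (Iio_mem_nhds (abs_pos.2 ht))
    filter_upwards [this] with ε hε
    rw [if_pos hε]

/-- **Cubic identity for the Hilbert transform of a probability density.**
Let `ρ` be a nonnegative, continuously differentiable, compactly supported probability
density on `ℝ`, and let `h` be its Hilbert transform, i.e. for every `x`,
`h(x) = lim_{ε→0⁺} (1/π) ∫_{|x−y|>ε} ρ(y)/(x−y) dy`.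
Then `(1/3) ∫ ρ(x)³ dx = ∫ ρ(x) h(x)² dx`. -/
theorem hilbert_transform_cubic_identity
    (ρ : ℝ → ℝ) (hρ_nonneg : ∀ x, 0 ≤ ρ x) (hρ_smooth : ContDiff ℝ 1 ρ)
    (hρ_supp : HasCompactSupport ρ) (hρ_prob : ∫ x : ℝ, ρ x = 1)
    (h : ℝ → ℝ)
    (hh : ∀ x : ℝ,
      Tendsto (fun ε : ℝ => (1 / π) * ∫ y in {y : ℝ | ε < |x - y|}, ρ y / (x - y))
        (nhdsWithin 0 (Ioi 0)) (nhds (h x))) :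
    (1 / 3) * ∫ x : ℝ, (ρ x) ^ 3 = ∫ x : ℝ, ρ x * (h x) ^ 2 := by
  have hc : Continuous ρ := hρ_smooth.continuous
  obtain ⟨L, hL⟩ := hρ_smooth.lipschitzWith_of_hasCompactSupport hρ_supp one_ne_zero
  obtain ⟨B, hB⟩ := hρ_supp.exists_bound_of_continuous hc
  obtain ⟨M, hM0, hM⟩ : ∃ M : ℝ, 0 < M ∧ ∀ y, M < |y| → ρ y = 0 := by
    obtain ⟨M, hM0, hM⟩ := hρ_supp.isCompact.isBounded.exists_pos_norm_le
    refine ⟨M, hM0, fun y hy => ?_⟩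
    by_contra hne
    exact absurd (hM y (subset_tsupport ρ hne)) (not_le.2 hy)
  -- real part limit
  have hre : ∀ x : ℝ, Tendsto (fun ε : ℝ => (htF ρ (x + ε * Complex.I)).re)
      (nhdsWithin 0 (Ioi 0)) (nhds (π * h x)) := by
    intro x
    have h1 := (ht_h_eq ρ hc hρ_supp L hL M hM x).const_mul (1 / π)
    have h2 := tendsto_nhds_unique (hh x) h1
    have h3 := ht_tendsto ρ hc hρ_supp (fun ε t => t / (t ^ 2 + ε ^ 2))
      (fun ε _ => by fun_prop) (fun ε hε t => ht_k1_bound ε t hε)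
      (fun ε t => by simp only [neg_sq]; ring) (fun ε hε t => ht_k1_bound2 ε t hε) ht_k1_lim
      L hL M hM x
    have h4 : π * h x = (1/2) * ∫ t, (ρ (x - t) - ρ (x + t)) * (1 / t) := by
      rw [h2]; field_simp
    rw [h4]
    refine h3.congr' ?_
    filter_upwards [self_mem_nhdsWithin] with ε hε
    exact (ht_F_re ρ hc hρ_supp x ε hε).symm
  have hrb : ∀ R : ℝ, ∃ C : ℝ, ∀ x : ℝ, |x| ≤ R → ∀ ε : ℝ, 0 < ε →
      |(htF ρ (x + ε * Complex.I)).re| ≤ C := by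
    intro R
    refine ⟨∫ t, (Icc (-(R + M)) (R + M)).indicator (fun _ => 2 * (L:ℝ)) t,
      fun x hx ε hε => ?_⟩
    rw [ht_F_re ρ hc hρ_supp x ε hε]
    exact ht_bound ρ hc hρ_supp (fun t => t / (t ^ 2 + ε ^ 2)) (by fun_prop) (1 / ε)
      (fun t => ht_k1_bound ε t hε) (fun t => by simp only [neg_sq]; ring)
      (fun t => ht_k1_bound2 ε t hε) L hL M hM R x hx
  have him := ht_F_im_lim ρ hc hρ_supp B hB
  have hFc : ∀ ε : ℝ, 0 < ε → Continuous fun x : ℝ => htF ρ (x + ε * Complex.I) := by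
    intro ε hε
    rw [continuous_iff_continuousAt]
    intro x
    have h1 := (ht_F_diff ρ hc hρ_supp (x + ε * Complex.I) (by simpa using hε)).continuousAt
    exact ContinuousAt.comp (f := fun x : ℝ => (x + ε * Complex.I : ℂ)) (g := htF ρ) h1
      (by fun_prop)
  have hI : ∀ z : ℂ, (z ^ 3).im = 3 * z.re ^ 2 * z.im - z.im ^ 3 := by
    intro z
    simp [pow_succ]
    ring
  -- the limit on bounded intervals
  have hlim : ∀ R : ℝ, 0 < R → Tendsto
      (fun ε : ℝ => ∫ x in (-R)..R, ((htF ρ (x + ε * Complex.I)) ^ 3).im)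
      (nhdsWithin 0 (Ioi 0))
      (nhds (∫ x in (-R)..R, π ^ 3 * (ρ x ^ 3 - 3 * (ρ x * h x ^ 2)))) := by
    intro R hR
    obtain ⟨C, hC⟩ := hrb R
    refine intervalIntegral.tendsto_integral_filter_of_dominated_convergence
      (fun _ => (C + B * π) ^ 3) ?_ ?_ ?_ ?_
    · filter_upwards [self_mem_nhdsWithin] with ε hε
      exact (Complex.continuous_im.comp ((hFc ε hε).pow 3)).aestronglyMeasurable
    · filter_upwards [self_mem_nhdsWithin] with ε hε
      refine ae_of_all _ fun x hx => ?_
      rw [uIoc_of_le (by linarith)] at hx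
      have hx' : |x| ≤ R := abs_le.2 ⟨hx.1.le, hx.2⟩
      refine (Complex.abs_im_le_norm _).trans ?_
      rw [norm_pow]
      gcongr
      refine (Complex.norm_le_abs_re_add_abs_im _).trans ?_
      exact add_le_add (hC x hx' ε hε) (ht_F_im_bound ρ hc hρ_supp B hB x ε hε)
    · simp
    · refine ae_of_all _ fun x _ => ?_
      have h1 := (((hre x).pow 2).const_mul 3).mul (him x)
      have h2 := h1.sub ((him x).pow 3)
      simp only [hI]
      convert h2 using 2
      ring
  have hbd : ∀ R : ℝ, 0 < R → 2 * M ≤ R →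
      |∫ x in (-R)..R, π ^ 3 * (ρ x ^ 3 - 3 * (ρ x * h x ^ 2))| ≤ 18 / R ^ 2 := by
    intro R hR hRM
    refine le_of_tendsto (hlim R hR).abs ?_
    filter_upwards [self_mem_nhdsWithin] with ε hε
    have h1 := ht_contour ρ hρ_nonneg hc hρ_supp hρ_prob M hM R hR hRM ε hε
    have h2 : ∫ x in (-R)..R, ((htF ρ (x + ε * Complex.I)) ^ 3).im
        = (∫ x in (-R)..R, (htF ρ (x + ε * Complex.I)) ^ 3).im :=
      Complex.imCLM.intervalIntegral_comp_comm (((hFc ε hε).pow 3).intervalIntegrable _ _)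
    rw [h2]
    exact (Complex.abs_im_le_norm _).trans h1
  have hfull : ∀ R : ℝ, 0 < R → 2 * M ≤ R →
      ∫ x in (-R)..R, π ^ 3 * (ρ x ^ 3 - 3 * (ρ x * h x ^ 2))
        = ∫ x, π ^ 3 * (ρ x ^ 3 - 3 * (ρ x * h x ^ 2)) := by
    intro R hR hRM
    refine intervalIntegral.integral_eq_integral_of_support_subset fun x hx => ?_
    by_contra hcon
    apply hx
    have : M < |x| := by
      by_contra h2
      have := abs_le.1 (not_lt.1 h2)
      exact hcon ⟨by linarith, by linarith⟩
    simp [hM x this]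
  have hzero : ∫ x, π ^ 3 * (ρ x ^ 3 - 3 * (ρ x * h x ^ 2)) = 0 := by
    have h1 : Tendsto (fun R : ℝ => 18 / R ^ 2) atTop (nhds 0) :=
      Tendsto.div_atTop tendsto_const_nhds (tendsto_pow_atTop two_ne_zero)
    have h2 : |∫ x, π ^ 3 * (ρ x ^ 3 - 3 * (ρ x * h x ^ 2))| ≤ 0 := by
      refine ge_of_tendsto h1 ?_
      filter_upwards [eventually_ge_atTop (2 * M)] with R hR
      rw [← hfull R (by linarith) hR]
      exact hbd R (by linarith) hR
    exact abs_nonpos_iff.1 h2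
  have hhm : AEStronglyMeasurable (fun x => π * h x) volume := by
    have hseq : Tendsto (fun n : ℕ => 1 / ((n : ℝ) + 1)) atTop (nhdsWithin 0 (Ioi 0)) :=
      tendsto_nhdsWithin_iff.2 ⟨tendsto_one_div_add_atTop_nhds_zero_nat,
        Eventually.of_forall fun n => by simp only [mem_Ioi]; positivity⟩
    refine aestronglyMeasurable_of_tendsto_ae atTop
      (f := fun (n : ℕ) (x : ℝ) => (htF ρ (x + ((1 / ((n : ℝ) + 1) : ℝ) : ℂ) * Complex.I)).re)
      (fun n => ?_) (ae_of_all _ fun x => (hre x).comp hseq)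
    exact (Complex.continuous_re.comp (hFc _ (by positivity))).aestronglyMeasurable
  have hhm' : AEStronglyMeasurable h volume := by
    refine (hhm.const_mul (1 / π)).congr (ae_of_all _ fun x => ?_)
    simp only
    field_simp
  have hρi : Integrable ρ := hc.integrable_of_hasCompactSupport hρ_supp
  have hint : Integrable (fun x => ρ x * h x ^ 2) := by
    obtain ⟨C, hC⟩ := hrb M
    have hhb : ∀ x, |x| ≤ M → |π * h x| ≤ C := by
      intro x hx
      refine le_of_tendsto (hre x).abs ?_
      filter_upwards [self_mem_nhdsWithin] with ε hε
      exact hC x hx ε hε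
    refine (hρi.mul_const ((C / π) ^ 2)).mono'
      (hc.aestronglyMeasurable.mul (hhm'.pow 2)) (ae_of_all _ fun x => ?_)
    by_cases hx : M < |x|
    · simp [hM x hx]
    have h1 := hhb x (not_lt.1 hx)
    rw [abs_mul, abs_of_pos pi_pos] at h1
    rw [norm_mul, norm_pow, Real.norm_of_nonneg (hρ_nonneg x)]
    have h2 : ‖h x‖ ≤ C / π := by
      rw [le_div_iff₀ pi_pos, mul_comm]; exact h1
    have := hρ_nonneg x
    gcongr
  have hint3 : Integrable (fun x => ρ x ^ 3) :=
    (hc.pow 3).integrable_of_hasCompactSupport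
      (hρ_supp.mono (fun x hx h0 => hx (by simp [h0])))
  rw [integral_const_mul, integral_sub hint3 (hint.const_mul 3), integral_const_mul] at hzero
  have hpi : π ^ 3 ≠ 0 := by positivity
  have := (mul_eq_zero.1 hzero).resolve_left hpi
  linarith
end

section
/- Let ρ : ℝ → ℝ be a nonnegative, continuously differentiable, compactly supported probability density. Suppose h : ℝ → ℝ satisfies h(x) = lim_{ε→0⁺} (1/π) ∫_{{y: |x−y|>ε}} ρ(y)/(x−y) dy for all x, and k : ℝ → ℝ satisfies k(x) = lim_{ε→0⁺} (1/π) ∫_{{y: |x−y|>ε}} ρ(y)h(y)/(x−y) dy for all x. Then for almost every x ∈ ℝ, h(x)² = ρ(x)² + 2 k(x). -/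
open MeasureTheory Real Filter Set

noncomputable def KK (s : ℝ) : ℂ := 1 / ((s:ℂ) + Complex.I) - {s : ℝ | 1 < |s|}.indicator (fun s : ℝ => (1 / (s:ℂ))) s

lemma s_add_I_ne (s : ℝ) : (s:ℂ) + Complex.I ≠ 0 := by
  intro h
  have := congrArg Complex.im h
  simp at this

lemma meas_abs (c : ℝ) : MeasurableSet {s : ℝ | c < |s|} :=
  measurableSet_lt measurable_const measurable_abs

lemma norm_s_add_I (s : ℝ) : ‖(s:ℂ) + Complex.I‖ = √(1 + s^2) := by
  rw [Complex.norm_def, Complex.normSq_apply]; simp; ring_nf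

lemma KK_bound (s : ℝ) : ‖KK s‖ ≤ 2 * (1 + s^2)⁻¹ := by
  unfold KK
  have hn := norm_s_add_I s
  by_cases hs : 1 < |s|
  · rw [indicator_of_mem (by exact hs)]
    have hs0 : s ≠ 0 := by rintro rfl; simp at hs; linarith
    have hs0' : (s:ℂ) ≠ 0 := by exact_mod_cast hs0
    have : 1 / ((s:ℂ) + Complex.I) - 1 / (s:ℂ) = -Complex.I / (s * (s + Complex.I)) := by
      have := s_add_I_ne s
      field_simp; ring
    rw [this, norm_div, norm_mul, hn]
    simp only [norm_neg, Complex.norm_I, Complex.norm_real, Real.norm_eq_abs]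
    have h2 : |s| ≤ √(1+s^2) := Real.abs_le_sqrt (by linarith)
    have h3 : 1 < s^2 := by rw [← sq_abs]; nlinarith
    rw [← div_eq_mul_inv, div_le_div_iff₀ (by positivity) (by positivity)]
    have : |s| * |s| = s^2 := by rw [← sq, sq_abs]
    nlinarith [abs_nonneg s]
  · rw [indicator_of_notMem (by exact hs), sub_zero, norm_div, hn]
    have h3 : s^2 ≤ 1 := by rw [← sq_abs]; nlinarith [abs_nonneg s]
    have h2 : 1 ≤ √(1+s^2) := Real.one_le_sqrt.2 (by nlinarith)
    rw [norm_one, ← div_eq_mul_inv, div_le_div_iff₀ (by positivity) (by positivity)]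
    nlinarith

lemma KK_meas : Measurable KK := by
  unfold KK
  refine Measurable.sub (by fun_prop) (Measurable.indicator (by fun_prop) (meas_abs 1))

lemma KK_int : Integrable KK :=
  Integrable.mono' (integrable_inv_one_add_sq.const_mul 2) KK_meas.aestronglyMeasurable
    (Eventually.of_forall KK_bound)

lemma KK_integral : ∫ s, KK s = - Complex.I * π := by
  have h1 : ∫ s, KK (-s) = ∫ s, KK s := integral_neg_eq_self KK volume
  have h2 : ∫ s, (KK s + KK (-s)) = (∫ s, KK s) + ∫ s, KK (-s) :=
    integral_add KK_int KK_int.comp_neg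
  have h3 : ∀ s : ℝ, KK s + KK (-s) = (-2 * Complex.I) * (((1 + s^2)⁻¹ : ℝ) : ℂ) := by
    intro s
    have e : KK s + KK (-s) = 1 / ((s:ℂ) + Complex.I) + 1 / (((-s:ℝ):ℂ) + Complex.I) := by
      unfold KK
      by_cases hs : 1 < |s|
      · rw [indicator_of_mem (by exact hs), indicator_of_mem (by simpa using hs)]
        push_cast; rw [div_neg]; ring
      · rw [indicator_of_notMem (by exact hs), indicator_of_notMem (by simpa using hs)]
        ring
    rw [e]
    have a := s_add_I_ne s
    have b := s_add_I_ne (-s)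
    have c : (1 + (s:ℂ)^2) ≠ 0 := by
      have : (1 + s^2 : ℝ) ≠ 0 := by positivity
      exact_mod_cast this
    push_cast at b ⊢
    field_simp
    ring_nf
    simp only [show Complex.I^3 = -Complex.I by rw [pow_succ, Complex.I_sq]; ring]
    ring
  simp_rw [h3] at h2
  rw [integral_const_mul, integral_complex_ofReal, integral_univ_inv_one_add_sq, h1] at h2
  linear_combination (-1/2) * h2

lemma approx_lim (f : ℝ → ℝ) (hf : Continuous f) (hc : HasCompactSupport f) (x : ℝ) :
    Tendsto (fun δ : ℝ => ∫ s, (f (x - δ * s) : ℂ) * KK s) (nhdsWithin 0 (Ioi 0))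
      (nhds ((f x : ℂ) * (- Complex.I * π))) := by
  obtain ⟨C, hC⟩ := hc.exists_bound_of_continuous hf
  rw [← KK_integral, ← integral_const_mul]
  refine tendsto_integral_filter_of_dominated_convergence (fun s => C * ‖KK s‖) ?_ ?_ ?_ ?_
  · refine Eventually.of_forall fun δ => ?_
    refine (Measurable.mul ?_ KK_meas).aestronglyMeasurable
    exact Complex.measurable_ofReal.comp (hf.measurable.comp (by fun_prop))
  · refine Eventually.of_forall fun δ => Eventually.of_forall fun s => ?_
    rw [norm_mul]
    gcongr
    simpa using hC (x - δ * s)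
  · exact KK_int.norm.const_mul C
  · refine Eventually.of_forall fun s => ?_
    have : Continuous fun δ : ℝ => (f (x - δ * s) : ℂ) * KK s := by fun_prop
    have := (this.tendsto 0).mono_left (nhdsWithin_le_nhds (s := Ioi 0))
    simpa using this

lemma trunc_int (f : ℝ → ℝ) (hf : Continuous f) (hc : HasCompactSupport f) (x ε : ℝ) (hε : 0 < ε) :
    Integrable (fun s => {s : ℝ | ε < |s|}.indicator (fun s => f (x - s) / s) s) := by
  have hi : Integrable (fun s => f (x - s)) :=
    (hf.integrable_of_hasCompactSupport hc).comp_sub_left x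
  refine Integrable.mono' (hi.norm.const_mul ε⁻¹) ?_ (Eventually.of_forall fun s => ?_)
  · refine (Measurable.indicator ?_ (meas_abs ε)).aestronglyMeasurable
    exact (hf.measurable.comp (by fun_prop)).div measurable_id
  · by_cases hs : ε < |s|
    · rw [indicator_of_mem (by exact hs), norm_div, div_eq_inv_mul]
      gcongr
      exact hs.le
    · rw [indicator_of_notMem (by exact hs), norm_zero]; positivity

lemma trunc_eq (f : ℝ → ℝ) (x ε : ℝ) :
    ∫ y in {y : ℝ | ε < |x - y|}, f y / (x - y)
      = ∫ s, {s : ℝ | ε < |s|}.indicator (fun s => f (x - s) / s) s := by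
  rw [← integral_indicator (measurableSet_lt measurable_const (by fun_prop))]
  rw [← integral_sub_left_eq_self _ volume x]
  congr 1; ext s
  simp [indicator]

lemma cauchy_lim (f : ℝ → ℝ) (hf : Continuous f) (hc : HasCompactSupport f) (x l : ℝ)
    (hl : Tendsto (fun ε : ℝ => (1 / π) * ∫ y in {y : ℝ | ε < |x - y|}, f y / (x - y))
        (nhdsWithin 0 (Ioi 0)) (nhds l)) :
    Tendsto (fun δ : ℝ => ∫ y, (f y : ℂ) / ((x:ℂ) + δ * Complex.I - y)) (nhdsWithin 0 (Ioi 0))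
      (nhds (π * l + (f x : ℂ) * (- Complex.I * π))) := by
  have h1 : Tendsto (fun ε : ℝ => ((π * ((1 / π) * ∫ y in {y : ℝ | ε < |x - y|}, f y / (x - y)) : ℝ) : ℂ)) (nhdsWithin 0 (Ioi 0)) (nhds ((π * l : ℝ) : ℂ)) :=
    (Complex.continuous_ofReal.tendsto _).comp (hl.const_mul π)
  rw [Complex.ofReal_mul] at h1
  refine (h1.add (approx_lim f hf hc x)).congr' ?_
  filter_upwards [self_mem_nhdsWithin] with δ hδ
  have hδ : 0 < δ := hδ
  have hδ' : (δ:ℂ) ≠ 0 := by exact_mod_cast hδ.ne'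
  rw [← mul_assoc, mul_one_div_cancel pi_ne_zero, one_mul, trunc_eq, ← integral_complex_ofReal]
  have ti := trunc_int f hf hc x δ hδ
  -- rescale
  have e1 : ∫ s, (({s : ℝ | δ < |s|}.indicator (fun s => f (x - s) / s) s : ℝ) : ℂ)
      = ∫ s, (δ:ℂ) * (({s : ℝ | δ < |s|}.indicator (fun s => f (x - s) / s) (δ * s) : ℝ) : ℂ) := by
    rw [integral_const_mul, Measure.integral_comp_mul_left (fun s => (({s : ℝ | δ < |s|}.indicator (fun s => f (x - s) / s) s : ℝ) : ℂ))]
    rw [abs_of_pos (by positivity), Complex.real_smul]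
    push_cast
    field_simp
  have i1 : Integrable (fun s => (δ:ℂ) * (({s : ℝ | δ < |s|}.indicator (fun s => f (x - s) / s) (δ * s) : ℝ) : ℂ)) :=
    ((ti.comp_mul_left' hδ.ne').ofReal).const_mul _
  have i2 : Integrable (fun s => (f (x - δ * s) : ℂ) * KK s) := by
    obtain ⟨C, hC⟩ := hc.exists_bound_of_continuous hf
    refine KK_int.bdd_mul (c := C) ?_ (Eventually.of_forall fun s => by simpa using hC (x - δ * s))
    exact (by fun_prop : Continuous fun s => (f (x - δ * s) : ℂ)).aestronglyMeasurable
  rw [e1, ← integral_add i1 i2]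
  have e2 : ∫ y, (f y : ℂ) / ((x:ℂ) + δ * Complex.I - y)
      = ∫ s, (δ:ℂ) * ((f (x - δ * s) : ℂ) / ((δ * s : ℝ) + δ * Complex.I)) := by
    rw [integral_const_mul, Measure.integral_comp_mul_left (fun s : ℝ => (f (x - s) : ℂ) / ((s : ℝ) + δ * Complex.I))]
    rw [abs_of_pos (by positivity), Complex.real_smul]
    rw [← integral_sub_left_eq_self _ volume x]
    push_cast
    field_simp
    congr 1; ext s; congr 1; ring
  rw [e2]
  congr 1; ext s
  have a := s_add_I_ne s
  have hm : δ < |δ * s| ↔ 1 < |s| := by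
    rw [abs_mul, abs_of_pos hδ]; exact lt_mul_iff_one_lt_right hδ
  have e3 : (δ:ℂ) * ((f (x - δ * s) : ℂ) / ((δ * s : ℝ) + δ * Complex.I)) = f (x - δ * s) * (1 / (s + Complex.I)) := by
    push_cast
    rw [← mul_add]; field_simp
  rw [e3]
  unfold KK
  by_cases hs : 1 < |s|
  · rw [indicator_of_mem (by exact hm.2 hs), indicator_of_mem (by exact hs)]
    have hs0 : (s:ℂ) ≠ 0 := by
      norm_cast; rintro rfl; simp at hs; linarith
    push_cast
    field_simp
    ring
  · rw [indicator_of_notMem (by exact fun h => hs (hm.1 h)), indicator_of_notMem (by exact hs)]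
    simp

noncomputable def DD (ρ : ℝ → ℝ) (x s : ℝ) : ℝ := (ρ (x - s) - ρ (x + s)) / s

lemma trunc_DD (ρ : ℝ → ℝ) (hf : Continuous ρ) (hc : HasCompactSupport ρ) (x ε : ℝ) (hε : 0 < ε) :
    ∫ y in {y : ℝ | ε < |x - y|}, ρ y / (x - y)
      = (1/2) * ∫ s, {s : ℝ | ε < |s|}.indicator (DD ρ x) s := by
  rw [trunc_eq]
  have ti := trunc_int ρ hf hc x ε hε
  have h1 := integral_neg_eq_self ({s : ℝ | ε < |s|}.indicator (fun s => ρ (x - s) / s)) volume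
  have h2 := integral_add ti ti.comp_neg
  have h3 : ∫ s, {s : ℝ | ε < |s|}.indicator (DD ρ x) s = ∫ s, ({s : ℝ | ε < |s|}.indicator (fun s => ρ (x - s) / s) s + {s : ℝ | ε < |s|}.indicator (fun s => ρ (x - s) / s) (-s)) := by
    congr 1; ext s
    by_cases hs : ε < |s|
    · rw [indicator_of_mem (by exact hs), indicator_of_mem (by exact hs), indicator_of_mem (by simpa using hs)]
      unfold DD
      rw [sub_neg_eq_add, div_neg]; ring
    · rw [indicator_of_notMem (by exact hs), indicator_of_notMem (by exact hs), indicator_of_notMem (by simpa using hs)]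
      ring
  rw [h3, h2, h1]; ring

lemma DD_bound (ρ : ℝ → ℝ) (h1 : ContDiff ℝ 1 ρ) (hc : HasCompactSupport ρ) (M : ℝ) :
    ∃ B : ℝ → ℝ, Integrable B ∧ (∀ s, 0 ≤ B s) ∧ ∀ x s, |x| ≤ M → ‖DD ρ x s‖ ≤ B s := by
  obtain ⟨L, hL⟩ := h1.lipschitzWith_of_hasCompactSupport hc (by norm_num)
  obtain ⟨R, hR⟩ := hc.isCompact.isBounded.subset_closedBall 0
  have hz : ∀ y, R < |y| → ρ y = 0 := by
    intro y hy
    by_contra h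
    have := hR (subset_tsupport _ h)
    simp at this; linarith
  refine ⟨(Icc (-(R + M)) (R + M)).indicator (fun _ => 2 * (L:ℝ)), ?_, ?_, ?_⟩
  · rw [integrable_indicator_iff measurableSet_Icc]
    exact integrableOn_const (by simp)
  · intro s; exact indicator_nonneg (fun _ _ => by positivity) _
  · intro x s hx
    by_cases hs : s ∈ Icc (-(R + M)) (R + M)
    · rw [indicator_of_mem hs]
      unfold DD
      rw [norm_div]
      have := hL.dist_le_mul (x - s) (x + s)
      rw [dist_eq_norm, dist_eq_norm] at this
      have e : ‖x - s - (x + s)‖ = 2 * ‖s‖ := by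
        rw [show x - s - (x + s) = -2 * s by ring, norm_mul]; simp
      rw [e] at this
      exact div_le_of_le_mul₀ (norm_nonneg _) (by positivity) (by linarith)
    · rw [indicator_of_notMem hs]
      have hs' : R + M < |s| := by
        rw [mem_Icc, ← abs_le] at hs; linarith
      have a := hz (x - s) (by
        have := abs_sub_abs_le_abs_sub s x
        rw [abs_sub_comm s x] at this; linarith)
      have b := hz (x + s) (by
        have := abs_sub_abs_le_abs_sub s (-x)
        rw [abs_neg, sub_neg_eq_add, add_comm s x] at this; linarith)
      simp [DD, a, b]

lemma DD_meas (ρ : ℝ → ℝ) (hf : Continuous ρ) (x : ℝ) : Measurable (DD ρ x) := by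
  unfold DD
  exact Measurable.div (by fun_prop) measurable_id

lemma DD_lim (ρ : ℝ → ℝ) (h1 : ContDiff ℝ 1 ρ) (hc : HasCompactSupport ρ) (x : ℝ) :
    Tendsto (fun ε : ℝ => ∫ s, {s : ℝ | ε < |s|}.indicator (DD ρ x) s)
      (nhdsWithin 0 (Ioi 0)) (nhds (∫ s, DD ρ x s)) := by
  obtain ⟨B, hB, hB0, hBb⟩ := DD_bound ρ h1 hc |x|
  refine tendsto_integral_filter_of_dominated_convergence B ?_ ?_ hB ?_
  · exact Eventually.of_forall fun ε => ((DD_meas ρ h1.continuous x).indicator (meas_abs ε)).aestronglyMeasurable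
  · exact Eventually.of_forall fun ε => Eventually.of_forall fun s =>
      (norm_indicator_le_norm_self _ _).trans (hBb x s le_rfl)
  · have : ∀ᵐ s : ℝ, s ≠ 0 := by simp [ae_iff]
    filter_upwards [this] with s hs
    refine tendsto_const_nhds.congr' ?_
    filter_upwards [nhdsWithin_le_nhds (Iio_mem_nhds (abs_pos.2 hs))] with ε hε
    rw [indicator_of_mem (by exact hε)]

lemma h_eq (ρ : ℝ → ℝ) (h1 : ContDiff ℝ 1 ρ) (hc : HasCompactSupport ρ) (x l : ℝ)
    (hl : Tendsto (fun ε : ℝ => (1 / π) * ∫ y in {y : ℝ | ε < |x - y|}, ρ y / (x - y))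
        (nhdsWithin 0 (Ioi 0)) (nhds l)) : l = (1/π) * ((1/2) * ∫ s, DD ρ x s) := by
  refine tendsto_nhds_unique hl (Tendsto.congr' ?_ (((DD_lim ρ h1 hc x).const_mul (1/2)).const_mul (1/π)))
  filter_upwards [self_mem_nhdsWithin] with ε hε
  rw [trunc_DD ρ h1.continuous hc x ε hε]

lemma DD_cont (ρ : ℝ → ℝ) (h1 : ContDiff ℝ 1 ρ) (hc : HasCompactSupport ρ) :
    Continuous (fun x => ∫ s, DD ρ x s) := by
  rw [continuous_iff_continuousAt]
  intro x
  obtain ⟨B, hB, hB0, hBb⟩ := DD_bound ρ h1 hc (|x| + 1)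
  have hcont := h1.continuous
  refine continuousAt_of_dominated (bound := B) ?_ ?_ hB ?_
  · exact Eventually.of_forall fun y => (DD_meas ρ h1.continuous y).aestronglyMeasurable
  · have : ∀ᶠ y in nhds x, |y| < |x| + 1 :=
      (continuous_abs.tendsto x).eventually (Iio_mem_nhds (by linarith))
    filter_upwards [this] with y hy
    exact Eventually.of_forall fun s => hBb y s hy.le
  · refine Eventually.of_forall fun s => ?_
    unfold DD
    fun_prop

lemma fubini_step (ρ : ℝ → ℝ) (hf : Continuous ρ) (hc : HasCompactSupport ρ) (z : ℂ)
    (hz : ∀ y : ℝ, z - y ≠ 0) (ε : ℝ) (hε : 0 < ε) :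
    ∫ p : ℝ × ℝ, {p : ℝ × ℝ | ε < |p.1 - p.2|}.indicator
      (fun p => ((ρ p.1 : ℂ) / (z - p.1)) * ((ρ p.2 : ℂ) / (z - p.2))) p
    = 2 * ∫ y : ℝ, ((ρ y : ℂ) / (z - y)) *
        ((∫ t in {t : ℝ | ε < |y - t|}, ρ t / (y - t) : ℝ) : ℂ) := by
  have gc : Continuous fun y : ℝ => (ρ y : ℂ) / (z - y) :=
    Continuous.div (by fun_prop) (by fun_prop) hz
  have gs : HasCompactSupport fun y : ℝ => (ρ y : ℂ) / (z - y) := by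
    refine hc.mono fun y hy => ?_
    intro h; apply hy; simp [h]
  have gi := gc.integrable_of_hasCompactSupport gs (μ := volume)
  have ri := hf.integrable_of_hasCompactSupport hc (μ := volume)
  have mA : MeasurableSet {p : ℝ × ℝ | ε < |p.1 - p.2|} :=
    measurableSet_lt measurable_const (by fun_prop)
  set Q : ℝ × ℝ → ℂ := {p : ℝ × ℝ | ε < |p.1 - p.2|}.indicator
    (fun p => ((ρ p.1 : ℂ) / (z - p.1)) * ((ρ p.2 / (p.1 - p.2) : ℝ) : ℂ)) with hQ
  have Qi : Integrable Q (volume.prod volume) := by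
    refine Integrable.mono' ((gi.norm.mul_prod ri.norm).const_mul ε⁻¹) ?_ (Eventually.of_forall fun p => ?_)
    · refine (Measurable.indicator ?_ mA).aestronglyMeasurable
      refine Measurable.mul (gc.measurable.comp measurable_fst) (Complex.measurable_ofReal.comp ?_)
      exact (hf.measurable.comp measurable_snd).div (by fun_prop)
    · by_cases hp : ε < |p.1 - p.2|
      · rw [hQ, indicator_of_mem (by exact hp), norm_mul, Complex.norm_real, norm_div (ρ p.2)]
        rw [mul_left_comm, div_eq_inv_mul (‖ρ p.2‖)]
        gcongr
        exact hp.le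
      · rw [hQ, indicator_of_notMem (by exact hp), norm_zero]; positivity
  have key : ∀ p : ℝ × ℝ, {p : ℝ × ℝ | ε < |p.1 - p.2|}.indicator
      (fun p => ((ρ p.1 : ℂ) / (z - p.1)) * ((ρ p.2 : ℂ) / (z - p.2))) p = Q p + Q p.swap := by
    intro p
    by_cases hp : ε < |p.1 - p.2|
    · rw [hQ, indicator_of_mem (by exact hp), indicator_of_mem (by exact hp), indicator_of_mem (by simpa [abs_sub_comm] using hp)]
      have a := hz p.1
      have b := hz p.2
      have c : (p.1 : ℂ) - p.2 ≠ 0 := by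
        intro h
        have : p.1 - p.2 = 0 := by exact_mod_cast h
        rw [this, abs_zero] at hp; linarith
      have d : (p.2 : ℂ) - p.1 = -(p.1 - p.2) := by ring
      simp only [Prod.fst_swap, Prod.snd_swap]
      push_cast
      rw [d]
      field_simp
      ring
    · rw [hQ, indicator_of_notMem (by exact hp), indicator_of_notMem (by exact hp), indicator_of_notMem (by simpa [abs_sub_comm] using hp)]
      simp
  simp_rw [key]
  rw [Measure.volume_eq_prod, integral_add Qi (show Integrable (fun p : ℝ × ℝ => Q p.swap) (volume.prod volume) from Qi.swap), integral_prod_swap, integral_prod _ Qi, ← two_mul]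
  congr 2; ext y
  rw [← integral_complex_ofReal, ← integral_const_mul, ← integral_indicator (measurableSet_lt measurable_const (by fun_prop))]
  congr 1

lemma square_eq (ρ h : ℝ → ℝ) (h1 : ContDiff ℝ 1 ρ) (hc : HasCompactSupport ρ) 
    (hh : ∀ x : ℝ,
      Tendsto (fun ε : ℝ => (1 / π) * ∫ y in {y : ℝ | ε < |x - y|}, ρ y / (x - y))
        (nhdsWithin 0 (Ioi 0)) (nhds (h x))) (z : ℂ) (hz : ∀ y : ℝ, z - y ≠ 0) :
    (∫ y : ℝ, (ρ y : ℂ) / (z - y)) ^ 2 = 2 * π * ∫ y : ℝ, ((ρ y * h y : ℝ) : ℂ) / (z - y) := by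
  have hf := h1.continuous
  have gc : Continuous fun y : ℝ => (ρ y : ℂ) / (z - y) :=
    Continuous.div (by fun_prop) (by fun_prop) hz
  have gs : HasCompactSupport fun y : ℝ => (ρ y : ℂ) / (z - y) := by
    refine hc.mono fun y hy => ?_
    intro h; apply hy; simp [h]
  have gi := gc.integrable_of_hasCompactSupport gs (μ := volume)
  have l1 : Tendsto (fun ε : ℝ => ∫ p : ℝ × ℝ, {p : ℝ × ℝ | ε < |p.1 - p.2|}.indicator
      (fun p => ((ρ p.1 : ℂ) / (z - p.1)) * ((ρ p.2 : ℂ) / (z - p.2))) p)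
      (nhdsWithin 0 (Ioi 0)) (nhds ((∫ y : ℝ, (ρ y : ℂ) / (z - y)) ^ 2)) := by
    rw [sq, ← integral_prod_mul, ← Measure.volume_eq_prod]
    refine tendsto_integral_filter_of_dominated_convergence _ ?_ ?_ (gi.mul_prod gi).norm ?_
    · refine Eventually.of_forall fun ε => (Measurable.indicator ?_ (measurableSet_lt measurable_const (by fun_prop))).aestronglyMeasurable
      exact (gc.measurable.comp measurable_fst).mul (gc.measurable.comp measurable_snd)
    · exact Eventually.of_forall fun ε => Eventually.of_forall fun s =>
        norm_indicator_le_norm_self _ _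
    · have : ∀ᵐ p : ℝ × ℝ, p.1 ≠ p.2 := by
        have md : MeasurableSet {p : ℝ × ℝ | p.1 ≠ p.2} :=
          (measurableSet_eq_fun measurable_fst measurable_snd).compl
        rw [Measure.volume_eq_prod, Measure.ae_prod_iff_ae_ae md]
        refine Eventually.of_forall fun x => ?_
        simp [ae_iff]
      filter_upwards [this] with p hp
      refine tendsto_const_nhds.congr' ?_
      filter_upwards [nhdsWithin_le_nhds (Iio_mem_nhds (abs_pos.2 (sub_ne_zero.2 hp)))] with ε hε
      rw [indicator_of_mem (by exact hε)]
  have l2 : Tendsto (fun ε : ℝ => 2 * ∫ y : ℝ, ((ρ y : ℂ) / (z - y)) *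
        ((∫ t in {t : ℝ | ε < |y - t|}, ρ t / (y - t) : ℝ) : ℂ)) (nhdsWithin 0 (Ioi 0))
      (nhds (2 * ∫ y : ℝ, ((ρ y : ℂ) / (z - y)) * ((π * h y : ℝ) : ℂ))) := by
    refine Tendsto.const_mul 2 ?_
    obtain ⟨R, hR⟩ := hc.isCompact.isBounded.subset_closedBall 0
    obtain ⟨B, hB, hB0, hBb⟩ := DD_bound ρ h1 hc R
    refine tendsto_integral_filter_of_dominated_convergence
      (fun y => ‖(ρ y : ℂ) / (z - y)‖ * ((1/2) * ∫ s, B s)) ?_ ?_ (gi.norm.mul_const _) ?_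
    · refine Eventually.of_forall fun ε => ?_
      refine gc.aestronglyMeasurable.mul (Complex.continuous_ofReal.comp_aestronglyMeasurable ?_)
      have mA : MeasurableSet {p : ℝ × ℝ | ε < |p.1 - p.2|} :=
        measurableSet_lt measurable_const (by fun_prop)
      have : Measurable ({p : ℝ × ℝ | ε < |p.1 - p.2|}.indicator (fun p => ρ p.2 / (p.1 - p.2))) :=
        Measurable.indicator ((hf.measurable.comp measurable_snd).div (by fun_prop)) mA
      have h2 := this.stronglyMeasurable.integral_prod_right' (ν := volume)
      convert h2.aestronglyMeasurable using 2 with y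
      rw [← integral_indicator (measurableSet_lt measurable_const (by fun_prop))]
      rfl
    · filter_upwards [self_mem_nhdsWithin] with ε hε
      refine Eventually.of_forall fun y => ?_
      by_cases hy : ρ y = 0
      · simp [hy]
      · have hyR : |y| ≤ R := by
          have := hR (subset_tsupport _ hy)
          simpa using this
        rw [norm_mul, Complex.norm_real, trunc_DD ρ hf hc y ε hε, norm_mul]
        gcongr
        · simp
        · refine norm_integral_le_of_norm_le hB (Eventually.of_forall fun s => ?_)
          exact (norm_indicator_le_norm_self _ _).trans (hBb y s hyR)
    · refine Eventually.of_forall fun y => Tendsto.const_mul _ ?_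
      refine (Complex.continuous_ofReal.tendsto _).comp ?_
      refine ((hh y).const_mul π).congr fun ε => ?_
      rw [← mul_assoc, mul_one_div_cancel pi_ne_zero, one_mul]
  have l3 := l2.congr' (f₂ := fun ε : ℝ => ∫ p : ℝ × ℝ, {p : ℝ × ℝ | ε < |p.1 - p.2|}.indicator
      (fun p => ((ρ p.1 : ℂ) / (z - p.1)) * ((ρ p.2 : ℂ) / (z - p.2))) p) (by
    filter_upwards [self_mem_nhdsWithin] with ε hε
    exact (fubini_step ρ hf hc z hz ε hε).symm)
  rw [tendsto_nhds_unique l1 l3, mul_assoc, ← integral_const_mul (π:ℂ)]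
  congr 1
  refine integral_congr_ae (Eventually.of_forall fun y => ?_)
  simp only []
  push_cast; ring



/-- **The identity `H[ρ]² = ρ² + 2 H[ρ H[ρ]]`.**
Let `ρ` be a nonnegative, continuously differentiable, compactly supported probability
density on `ℝ`.  Let `h` be the Hilbert transform of `ρ`, i.e. for every `x`,
`h(x) = lim_{ε→0⁺} (1/π) ∫_{|x−y|>ε} ρ(y)/(x−y) dy`, and let `k` be the Hilbert transform
of `ρ h`.  Then for almost every `x ∈ ℝ`, `h(x)² = ρ(x)² + 2 k(x)`. -/
theorem hilbert_transform_square_identity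
    (ρ : ℝ → ℝ) (hρ_nonneg : ∀ x, 0 ≤ ρ x) (hρ_smooth : ContDiff ℝ 1 ρ)
    (hρ_supp : HasCompactSupport ρ) (hρ_prob : ∫ x : ℝ, ρ x = 1)
    (h k : ℝ → ℝ)
    (hh : ∀ x : ℝ,
      Tendsto (fun ε : ℝ => (1 / π) * ∫ y in {y : ℝ | ε < |x - y|}, ρ y / (x - y))
        (nhdsWithin 0 (Ioi 0)) (nhds (h x)))
    (hk : ∀ x : ℝ,
      Tendsto (fun ε : ℝ => (1 / π) * ∫ y in {y : ℝ | ε < |x - y|}, ρ y * h y / (x - y))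
        (nhdsWithin 0 (Ioi 0)) (nhds (k x))) :
    ∀ᵐ x : ℝ, (h x) ^ 2 = (ρ x) ^ 2 + 2 * k x := by
  have hcont : Continuous h := by
    have : h = fun x => (1/π) * ((1/2) * ∫ s, DD ρ x s) := by
      ext x; exact h_eq ρ hρ_smooth hρ_supp x _ (hh x)
    rw [this]
    have := DD_cont ρ hρ_smooth hρ_supp
    fun_prop
  have hρc := hρ_smooth.continuous
  refine Eventually.of_forall fun x => ?_
  have a := cauchy_lim ρ hρc hρ_supp x (h x) (hh x)
  have b := cauchy_lim (fun y => ρ y * h y) (hρc.mul hcont) (hρ_supp.mul_right) x (k x) (hk x)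
  have c := tendsto_nhds_unique (a.pow 2) (Tendsto.congr' ?_ (b.const_mul (2 * (π:ℂ))))
  · have hp : (π:ℂ) ≠ 0 := by exact_mod_cast pi_ne_zero
    have d : ((h x : ℂ) + ρ x * (-Complex.I))^2 = 2 * (k x + (ρ x * h x : ℝ) * (-Complex.I)) := by
      have hp2 : (π:ℂ)^2 ≠ 0 := pow_ne_zero 2 hp
      apply mul_left_cancel₀ hp2
      linear_combination c
    have := congrArg Complex.re d
    simp [sq] at this
    linarith
  · filter_upwards [self_mem_nhdsWithin] with δ hδ
    refine (square_eq ρ h hρ_smooth hρ_supp hh _ ?_).symm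
    intro y hy
    have := congrArg Complex.im hy
    simp at this
    exact (ne_of_gt hδ) this
end

section
/- Let m, n, p ≥ 1, let F be an m×n random matrix and X an n×p random matrix, all entries being i.i.d. standard Gaussians and F independent of X. Define Z_{μl} = n^{−1/2} ∑_{i=1}^n F_{μi} X_{il}. Then: (i) for all indices, E[Z_{μ₁l₁} Z_{μ₂l₂}] = δ_{μ₁μ₂} δ_{l₁l₂}; and (ii) for all μ₁ ≠ μ₂ and l₁ ≠ l₂, E[Z_{μ₁l₁} Z_{μ₁l₂} Z_{μ₂l₂} Z_{μ₂l₁}] = 1/n. In particular, this fourth moment differs from the value 0 that Wick's (Isserlis') formula would give for jointly Gaussian centered variables with the covariances in (i), so the family (Z_{μl}) is not asymptotically jointly Gaussian. -/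
open MeasureTheory ProbabilityTheory

lemma pm_memLp {Ω ι : Type*} {mΩ : MeasurableSpace Ω} (P : Measure Ω) [IsProbabilityMeasure P]
    (G : ι → Ω → ℝ) (hG : ∀ a, Measurable (G a)) (hg : ∀ a, P.map (G a) = gaussianReal 0 1)
    (L : List ι) : ∀ q : ENNReal, q ≠ ⊤ → MemLp (fun ω => (L.map (fun a => G a ω)).prod) q P := by
  induction L with
  | nil => intro q hq; simpa using memLp_const (1 : ℝ)
  | cons a L ih =>
    intro q hq
    have h2 : 2 * q ≠ ⊤ := ENNReal.mul_ne_top (by simp) hq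
    have h1 : MemLp (G a) (2 * q) P := by
      have := memLp_id_gaussianReal' (μ := 0) (v := 1) (2 * q) h2
      rw [← hg a] at this
      exact (memLp_map_measure_iff (by fun_prop) (hG a).aemeasurable).1 this
    have : ENNReal.HolderTriple (2 * q) (2 * q) q := ⟨by
      rw [ENNReal.mul_inv (by simp) (by simp), ← add_mul, ENNReal.inv_two_add_inv_two, one_mul]⟩
    simpa using (ih (2 * q) h2).mul' h1

lemma pm_integral {Ω ι : Type*} [Fintype ι] [DecidableEq ι] {mΩ : MeasurableSpace Ω}
    (P : Measure Ω) [IsProbabilityMeasure P]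
    (G : ι → Ω → ℝ) (hG : ∀ a, Measurable (G a)) (hg : ∀ a, P.map (G a) = gaussianReal 0 1)
    (hi : iIndepFun G P) (L : List ι) :
    ∫ ω, (L.map (fun a => G a ω)).prod ∂P = ∏ a, ∫ x, x ^ L.count a ∂(gaussianReal 0 1) := by
  have h : ∀ ω, (L.map (fun a => G a ω)).prod = ∏ a, (fun x => x ^ L.count a) (G a ω) := by
    intro ω
    rw [Finset.prod_list_map_count]
    refine Finset.prod_subset (Finset.subset_univ _) fun x _ hx => ?_
    rw [List.count_eq_zero_of_not_mem (by simpa using hx), pow_zero]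
  simp_rw [h]
  rw [hi.integral_fun_prod_comp (f := fun a x => x ^ L.count a) (fun a => (hG a).aemeasurable)
    (fun a => by fun_prop)]
  refine Finset.prod_congr rfl fun a _ => ?_
  rw [← hg a, integral_map (hG a).aemeasurable (by fun_prop)]

lemma pm_zero {Ω ι : Type*} [Fintype ι] [DecidableEq ι] {mΩ : MeasurableSpace Ω}
    (P : Measure Ω) [IsProbabilityMeasure P]
    (G : ι → Ω → ℝ) (hG : ∀ a, Measurable (G a)) (hg : ∀ a, P.map (G a) = gaussianReal 0 1)
    (hi : iIndepFun G P) (L : List ι) (a : ι) (ha : L.count a = 1) :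
    ∫ ω, (L.map (fun a => G a ω)).prod ∂P = 0 := by
  rw [pm_integral P G hG hg hi]
  apply Finset.prod_eq_zero (Finset.mem_univ a)
  simp [ha, integral_id_gaussianReal]

lemma pm_one {Ω ι : Type*} [Fintype ι] [DecidableEq ι] {mΩ : MeasurableSpace Ω}
    (P : Measure Ω) [IsProbabilityMeasure P]
    (G : ι → Ω → ℝ) (hG : ∀ a, Measurable (G a)) (hg : ∀ a, P.map (G a) = gaussianReal 0 1)
    (hi : iIndepFun G P) (L : List ι) (ha : ∀ a, L.count a = 0 ∨ L.count a = 2) :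
    ∫ ω, (L.map (fun a => G a ω)).prod ∂P = 1 := by
  rw [pm_integral P G hG hg hi]
  apply Finset.prod_eq_one
  intro a _
  rcases ha a with h | h
  · simp [h]
  · rw [h, ← variance_of_integral_eq_zero (X := fun x => x) (by fun_prop)
      (by simp [integral_id_gaussianReal]), variance_fun_id_gaussianReal]
    simp

/-- **Second and fourth moments of `Z_{μl} = n^{−1/2} ∑_i F_{μi} X_{il}`.**
Let `F` be an `m × n` and `X` an `n × p` random matrix, all entries i.i.d. standard Gaussian
and jointly independent.  Then (i) `E[Z_{μ₁l₁} Z_{μ₂l₂}] = δ_{μ₁μ₂} δ_{l₁l₂}`, and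
(ii) for `μ₁ ≠ μ₂`, `l₁ ≠ l₂`, `E[Z_{μ₁l₁} Z_{μ₁l₂} Z_{μ₂l₂} Z_{μ₂l₁}] = 1/n` — a value
differing from the `0` Wick's formula would give for jointly Gaussian centered variables
with the covariance (i), so the family `(Z_{μl})` is not jointly Gaussian. -/
theorem product_matrix_moments
    {Ω : Type*} {mΩ : MeasurableSpace Ω} (P : Measure Ω) [IsProbabilityMeasure P]
    (m n p : ℕ) (hm : 1 ≤ m) (hn : 1 ≤ n) (hp : 1 ≤ p)
    (F : Fin m → Fin n → Ω → ℝ) (X : Fin n → Fin p → Ω → ℝ)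
    (hFmeas : ∀ μ i, Measurable (F μ i)) (hXmeas : ∀ i l, Measurable (X i l))
    (hindep : iIndepFun
      (Sum.elim (fun q : Fin m × Fin n => F q.1 q.2)
        (fun q : Fin n × Fin p => X q.1 q.2)) P)
    (hFgauss : ∀ μ i, P.map (F μ i) = gaussianReal 0 1)
    (hXgauss : ∀ i l, P.map (X i l) = gaussianReal 0 1)
    (Z : Fin m → Fin p → Ω → ℝ)
    (hZ : ∀ μ l ω, Z μ l ω = (Real.sqrt n)⁻¹ * ∑ i : Fin n, F μ i ω * X i l ω) :
    (∀ μ₁ l₁ μ₂ l₂, ∫ ω, Z μ₁ l₁ ω * Z μ₂ l₂ ω ∂P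
        = if μ₁ = μ₂ ∧ l₁ = l₂ then 1 else 0)
    ∧ (∀ μ₁ μ₂ l₁ l₂, μ₁ ≠ μ₂ → l₁ ≠ l₂ →
        ∫ ω, Z μ₁ l₁ ω * Z μ₁ l₂ ω * Z μ₂ l₂ ω * Z μ₂ l₁ ω ∂P = 1 / (n : ℝ)) := by
  classical
  set G := (Sum.elim (fun q : Fin m × Fin n => F q.1 q.2)
        (fun q : Fin n × Fin p => X q.1 q.2)) with hGdef
  have hG : ∀ a, Measurable (G a) := by
    rintro (q | q)
    · exact hFmeas _ _
    · exact hXmeas _ _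
  have hg : ∀ a, P.map (G a) = gaussianReal 0 1 := by
    rintro (q | q)
    · exact hFgauss _ _
    · exact hXgauss _ _
  have hF : ∀ μ i ω, F μ i ω = G (Sum.inl (μ, i)) ω := fun _ _ _ => rfl
  have hX : ∀ i l ω, X i l ω = G (Sum.inr (i, l)) ω := fun _ _ _ => rfl
  have hint : ∀ L : List ((Fin m × Fin n) ⊕ (Fin n × Fin p)),
      Integrable (fun ω => (L.map (fun a => G a ω)).prod) P := fun L =>
    (pm_memLp P G hG hg L 1 (by simp)).integrable le_rfl
  have h0 := pm_zero P G hG hg hindep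
  have h1 := pm_one P G hG hg hindep
  clear_value G
  have hn0 : (n : ℝ) ≠ 0 := by positivity
  have hs : (Real.sqrt n)⁻¹ * (Real.sqrt n)⁻¹ = (n : ℝ)⁻¹ := by
    rw [← mul_inv, Real.mul_self_sqrt (by positivity)]
  constructor
  · intro μ₁ l₁ μ₂ l₂
    let L : Fin n → Fin n → List ((Fin m × Fin n) ⊕ (Fin n × Fin p)) := fun i j =>
      [.inl (μ₁, i), .inr (i, l₁), .inl (μ₂, j), .inr (j, l₂)]
    have e : ∀ ω, Z μ₁ l₁ ω * Z μ₂ l₂ ω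
        = (n : ℝ)⁻¹ * ∑ i, ∑ j, ((L i j).map (fun a => G a ω)).prod := by
      intro ω
      rw [hZ, hZ, mul_mul_mul_comm, hs, Finset.sum_mul_sum]
      simp only [L, hF, hX, List.map_cons, List.map_nil, List.prod_cons, List.prod_nil, mul_one,
        mul_assoc]
    simp_rw [e]
    rw [integral_const_mul, integral_finsetSum _ fun i _ => integrable_finsetSum _ fun j _ => hint _]
    simp_rw [integral_finsetSum _ fun j _ => hint _]
    have key : ∀ i j, ∫ ω, ((L i j).map (fun a => G a ω)).prod ∂P
        = if i = j then (if μ₁ = μ₂ ∧ l₁ = l₂ then 1 else 0) else 0 := by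
      intro i j
      by_cases hij : i = j
      · subst hij
        by_cases hμ : μ₁ = μ₂
        · by_cases hl : l₁ = l₂
          · subst hμ hl
            simp only [and_self, if_true]
            apply h1
            rintro (⟨x, y⟩ | ⟨x, y⟩) <;> simp [L, List.count_cons] <;> grind
          · simp only [hl, and_false, if_true, if_false]
            apply h0 _ (.inr (i, l₁))
            simp [L, List.count_cons]; grind
        · simp only [hμ, false_and, if_true, if_false]
          apply h0 _ (.inl (μ₁, i))
          simp [L, List.count_cons]; grind
      · simp only [hij, if_false]
        apply h0 _ (.inl (μ₁, i))
        simp [L, List.count_cons]; grind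
    simp_rw [key]
    simp [hn0]
  · intro μ₁ μ₂ l₁ l₂ hμ hl
    let L : Fin n → Fin n → Fin n → Fin n → List ((Fin m × Fin n) ⊕ (Fin n × Fin p)) :=
      fun i j k h => [.inl (μ₁, i), .inr (i, l₁), .inl (μ₁, j), .inr (j, l₂),
        .inl (μ₂, k), .inr (k, l₂), .inl (μ₂, h), .inr (h, l₁)]
    have e : ∀ ω, Z μ₁ l₁ ω * Z μ₁ l₂ ω * Z μ₂ l₂ ω * Z μ₂ l₁ ω
        = ((n : ℝ)⁻¹ * (n : ℝ)⁻¹) *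
          ∑ i, ∑ j, ∑ k, ∑ h, ((L i j k h).map (fun a => G a ω)).prod := by
      intro ω
      rw [hZ, hZ, hZ, hZ, ← hs]
      have : ∀ s a b c d : ℝ, s * a * (s * b) * (s * c) * (s * d)
        = (s * s * (s * s)) * (a * (b * (c * d))) := by intros; ring
      rw [this]
      congr 1
      simp only [L, hF, hX, List.map_cons, List.map_nil, List.prod_cons, List.prod_nil, mul_one]
      simp only [Finset.sum_mul]
      simp only [Finset.mul_sum, mul_assoc]
    simp_rw [e]
    rw [integral_const_mul, integral_finsetSum _ fun i _ => integrable_finsetSum _ fun j _ =>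
      integrable_finsetSum _ fun k _ => integrable_finsetSum _ fun h _ => hint _]
    simp_rw [integral_finsetSum _ fun j _ =>
      integrable_finsetSum _ fun k _ => integrable_finsetSum _ fun h _ => hint _]
    simp_rw [integral_finsetSum _ fun k _ => integrable_finsetSum _ fun h _ => hint _]
    simp_rw [integral_finsetSum _ fun h _ => hint _]
    have key : ∀ i j k h, ∫ ω, ((L i j k h).map (fun a => G a ω)).prod ∂P
        = if i = j then (if j = k then (if k = h then 1 else 0) else 0) else 0 := by
      intro i j k h
      have hμ' := hμ.symm
      have hl' := hl.symm
      by_cases hij : i = j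
      · by_cases hjk : j = k
        · by_cases hkh : k = h
          · subst hij hjk hkh
            simp only [if_true]
            apply h1
            rintro (⟨x, y⟩ | ⟨x, y⟩) <;> simp [L, List.count_cons] <;> grind
          · simp only [hij, hjk, hkh, if_true, if_false]
            apply h0 _ (.inl (μ₂, k))
            simp [L, List.count_cons]; grind
        · simp only [hij, hjk, if_true, if_false]
          apply h0 _ (.inr (j, l₂))
          simp [L, List.count_cons]; grind
      · simp only [hij, if_false]
        apply h0 _ (.inl (μ₁, i))
        simp [L, List.count_cons]; grind
    simp_rw [key]
    simp [hn0]
end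

section
/- Let m, n, p ≥ 1, let F be an m×n random matrix and X an n×p random matrix with i.i.d. standard Gaussian entries, F independent of X, and Z_{μl} = n^{−1/2} ∑_{i=1}^n F_{μi} X_{il}. Then (1/n³) ∑_{μ₁≠μ₂} ∑_{l₁≠l₂} E[Z_{μ₁l₁} Z_{μ₁l₂} Z_{μ₂l₂} Z_{μ₂l₁}] = m(m−1) p(p−1) / n⁴. Consequently, for sequences m = m(n), p = p(n) with m/n → α > 0 and p/n → ψ > 0 as n → ∞, this quantity converges to α²ψ². -/
open MeasureTheory ProbabilityTheory Filter

lemma aux_moment {ι Ω : Type*} [Fintype ι] [DecidableEq ι] {mΩ : MeasurableSpace Ω}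
    (P : Measure Ω) (Y : ι → Ω → ℝ) (hY : ∀ s, Measurable (Y s))
    (hind : iIndepFun Y P) (hG : ∀ s, P.map (Y s) = gaussianReal 0 1) (g : Fin 8 → ι) :
    ∫ ω, ∏ a, Y (g a) ω ∂P
      = ∏ s, ∫ x, x ^ (Finset.univ.filter (fun a => g a = s)).card ∂(gaussianReal 0 1) := by
  have h1 : ∀ ω, ∏ a, Y (g a) ω
      = ∏ s, (fun x : ℝ => x ^ (Finset.univ.filter (fun a => g a = s)).card) (Y s ω) := by
    intro ω
    rw [← Finset.prod_fiberwise' Finset.univ g (fun s => Y s ω)]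
    simp
  simp_rw [h1]
  rw [hind.integral_fun_prod_comp
    (f := fun s => (fun x : ℝ => x ^ (Finset.univ.filter (fun a => g a = s)).card))
    (fun s => (hY s).aemeasurable) (fun s => by fun_prop)]
  refine Finset.prod_congr rfl fun s _ => ?_
  rw [← hG s, integral_map (hY s).aemeasurable (by fun_prop)]

lemma aux_integrable {ι Ω : Type*} {mΩ : MeasurableSpace Ω}
    (P : Measure Ω) (Y : ι → Ω → ℝ) (hY : ∀ s, Measurable (Y s))
    (hG : ∀ s, P.map (Y s) = gaussianReal 0 1) (g : Fin 8 → ι) :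
    Integrable (fun ω => ∏ a, Y (g a) ω) P := by
  have h : ∀ a ∈ (Finset.univ : Finset (Fin 8)), MemLp (Y (g a)) 8 P := by
    intro a _
    have h2 := memLp_id_gaussianReal' (μ := 0) (v := 1) 8 (by simp)
    rw [← hG (g a), memLp_map_measure_iff (by fun_prop) (hY _).aemeasurable] at h2
    exact h2
  have h3 := MemLp.prod' h
  have h4 : (∑ i : Fin 8, (8 : ENNReal)⁻¹)⁻¹ = 1 := by
    simp only [Finset.sum_const, Finset.card_univ, Fintype.card_fin, nsmul_eq_mul]
    have h5 : ((8 : ℕ) : ENNReal) * 8⁻¹ = 1 := ENNReal.mul_inv_cancel (by simp) (by simp)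
    rw [h5, inv_one]
  rw [h4] at h3
  exact memLp_one_iff_integrable.1 h3

lemma aux_sq : ∫ x, x ^ 2 ∂(gaussianReal 0 1) = 1 := by
  have := variance_fun_id_gaussianReal (μ := 0) (v := 1)
  rw [variance_eq_integral measurable_id'.aemeasurable] at this
  simpa using this

lemma aux_count (m : ℕ) (c : ℝ) (a : Fin m) :
    ∑ b : Fin m, (if a ≠ b then c else 0) = ((m : ℝ) - 1) * c := by
  have : ∀ b : Fin m, (if a ≠ b then c else 0) = c - (if a = b then c else 0) := by
    intro b; split_ifs <;> simp_all
  simp_rw [this]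
  rw [Finset.sum_sub_distrib]
  simp
  ring

def auxg {m n p : ℕ} (μ₁ μ₂ : Fin m) (l₁ l₂ : Fin p) (i j k l : Fin n) :
    Fin 8 → (Fin m × Fin n) ⊕ (Fin n × Fin p) :=
  ![Sum.inl (μ₁, i), Sum.inr (i, l₁), Sum.inl (μ₁, j), Sum.inr (j, l₂),
    Sum.inl (μ₂, k), Sum.inr (k, l₂), Sum.inl (μ₂, l), Sum.inr (l, l₁)]

lemma aux_prod {m n p : ℕ} {μ₁ μ₂ : Fin m} {l₁ l₂ : Fin p} (hμ : μ₁ ≠ μ₂) (hl : l₁ ≠ l₂)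
    (i j k l : Fin n) :
    ∏ s, ∫ x, x ^ (Finset.univ.filter (fun a => auxg μ₁ μ₂ l₁ l₂ i j k l a = s)).card
      ∂(gaussianReal 0 1) = if j = i ∧ k = i ∧ l = i then 1 else 0 := by
  have key : ∀ s, (Finset.univ.filter (fun a => auxg μ₁ μ₂ l₁ l₂ i j k l a = s)).card = 1 →
    ∏ s, ∫ x, x ^ (Finset.univ.filter (fun a => auxg μ₁ μ₂ l₁ l₂ i j k l a = s)).card
      ∂(gaussianReal 0 1) = 0 := by
    intro s hs
    refine Finset.prod_eq_zero (Finset.mem_univ s) ?_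
    rw [hs]; simp
  by_cases h1 : j = i
  · by_cases h2 : k = j
    · by_cases h3 : l = k
      · subst h1 h2 h3
        rw [if_pos ⟨rfl, rfl, rfl⟩]
        refine Finset.prod_eq_one fun s _ => ?_
        have : (Finset.univ.filter (fun a => auxg μ₁ μ₂ l₁ l₂ l l l l a = s)).card = 0 ∨
          (Finset.univ.filter (fun a => auxg μ₁ μ₂ l₁ l₂ l l l l a = s)).card = 2 := by
          rw [Finset.card_filter, Fin.sum_univ_eight]
          rcases s with ⟨a, b⟩ | ⟨a, b⟩ <;> simp [auxg] <;> grind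
        rcases this with h | h
        · rw [h]; simp
        · rw [h]; exact aux_sq
      · rw [if_neg (by grind)]
        apply key (Sum.inl (μ₂, k))
        rw [Finset.card_filter, Fin.sum_univ_eight]
        simp [auxg]; grind
    · rw [if_neg (by grind)]
      apply key (Sum.inr (j, l₂))
      rw [Finset.card_filter, Fin.sum_univ_eight]
      simp [auxg]; grind
  · rw [if_neg (by grind)]
    apply key (Sum.inl (μ₁, i))
    rw [Finset.card_filter, Fin.sum_univ_eight]
    simp [auxg]; grind


/-- **The quantity `L₄` and its limit `α²ψ²`.**
With `Z_{μl} = n^{−1/2} ∑_i F_{μi} X_{il}` for `F, X` with jointly independent standard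
Gaussian entries,
`(1/n³) ∑_{μ₁≠μ₂} ∑_{l₁≠l₂} E[Z_{μ₁l₁} Z_{μ₁l₂} Z_{μ₂l₂} Z_{μ₂l₁}] = m(m−1)p(p−1)/n⁴`;
consequently, for sequences `m = m(n)`, `p = p(n)` with `m/n → α > 0` and `p/n → ψ > 0`,
this quantity converges to `α²ψ²`. -/
theorem L4_formula_and_limit
    {Ω : Type*} {mΩ : MeasurableSpace Ω} (P : Measure Ω) [IsProbabilityMeasure P]
    (m n p : ℕ) (hm : 1 ≤ m) (hn : 1 ≤ n) (hp : 1 ≤ p)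
    (F : Fin m → Fin n → Ω → ℝ) (X : Fin n → Fin p → Ω → ℝ)
    (hFmeas : ∀ μ i, Measurable (F μ i)) (hXmeas : ∀ i l, Measurable (X i l))
    (hindep : iIndepFun
      (Sum.elim (fun q : Fin m × Fin n => F q.1 q.2)
        (fun q : Fin n × Fin p => X q.1 q.2)) P)
    (hFgauss : ∀ μ i, P.map (F μ i) = gaussianReal 0 1)
    (hXgauss : ∀ i l, P.map (X i l) = gaussianReal 0 1)
    (Z : Fin m → Fin p → Ω → ℝ)
    (hZ : ∀ μ l ω, Z μ l ω = (Real.sqrt n)⁻¹ * ∑ i : Fin n, F μ i ω * X i l ω) :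
    (1 / (n : ℝ) ^ 3) * ∑ μ₁ : Fin m, ∑ μ₂ : Fin m, ∑ l₁ : Fin p, ∑ l₂ : Fin p,
        (if μ₁ ≠ μ₂ ∧ l₁ ≠ l₂ then
          ∫ ω, Z μ₁ l₁ ω * Z μ₁ l₂ ω * Z μ₂ l₂ ω * Z μ₂ l₁ ω ∂P else 0)
      = (m : ℝ) * ((m : ℝ) - 1) * (p : ℝ) * ((p : ℝ) - 1) / (n : ℝ) ^ 4
    ∧ (∀ (ms ps : ℕ → ℕ) (α ψ : ℝ), 0 < α → 0 < ψ →
        Tendsto (fun N : ℕ => (ms N : ℝ) / (N : ℝ)) atTop (nhds α) →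
        Tendsto (fun N : ℕ => (ps N : ℝ) / (N : ℝ)) atTop (nhds ψ) →
        Tendsto (fun N : ℕ =>
            (ms N : ℝ) * ((ms N : ℝ) - 1) * (ps N : ℝ) * ((ps N : ℝ) - 1) / (N : ℝ) ^ 4)
          atTop (nhds (α ^ 2 * ψ ^ 2))) := by
  constructor
  · have hn0 : (n : ℝ) ≠ 0 := by positivity
    have hE : ∀ μ₁ μ₂ : Fin m, ∀ l₁ l₂ : Fin p, μ₁ ≠ μ₂ → l₁ ≠ l₂ →
        ∫ ω, Z μ₁ l₁ ω * Z μ₁ l₂ ω * Z μ₂ l₂ ω * Z μ₂ l₁ ω ∂P = 1 / (n : ℝ) := by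
      intro μ₁ μ₂ l₁ l₂ hμ hl
      set Y := (Sum.elim (fun q : Fin m × Fin n => F q.1 q.2)
        (fun q : Fin n × Fin p => X q.1 q.2)) with hYdef
      have hY : ∀ s, Measurable (Y s) := by
        rintro (s | s)
        · exact hFmeas _ _
        · exact hXmeas _ _
      have hG : ∀ s, P.map (Y s) = gaussianReal 0 1 := by
        rintro (s | s)
        · exact hFgauss _ _
        · exact hXgauss _ _
      have hexp : ∀ ω, Z μ₁ l₁ ω * Z μ₁ l₂ ω * Z μ₂ l₂ ω * Z μ₂ l₁ ω
          = ((Real.sqrt n)⁻¹) ^ 4 * ∑ i : Fin n, ∑ j : Fin n, ∑ k : Fin n, ∑ l : Fin n,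
            ∏ a, Y (auxg μ₁ μ₂ l₁ l₂ i j k l a) ω := by
        intro ω
        have : ∀ i j k l, ∏ a, Y (auxg μ₁ μ₂ l₁ l₂ i j k l a) ω
          = (F μ₁ i ω * X i l₁ ω) * ((F μ₁ j ω * X j l₂ ω) * ((F μ₂ k ω * X k l₂ ω) *
            (F μ₂ l ω * X l l₁ ω))) := by
          intro i j k l
          rw [Fin.prod_univ_eight]
          simp [auxg, hYdef]
          ring
        simp_rw [this, ← Finset.mul_sum, ← Finset.sum_mul, hZ]
        ring
      simp_rw [hexp]
      have hint := fun i j k l => aux_integrable P Y hY hG (auxg μ₁ μ₂ l₁ l₂ i j k l)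
      rw [integral_const_mul, integral_finsetSum _ (fun i _ => integrable_finsetSum _ fun j _ =>
        integrable_finsetSum _ fun k _ => integrable_finsetSum _ fun l _ => hint i j k l)]
      have h2 : ∀ i : Fin n, ∫ ω, ∑ j : Fin n, ∑ k : Fin n, ∑ l : Fin n,
            ∏ a, Y (auxg μ₁ μ₂ l₁ l₂ i j k l a) ω ∂P = 1 := by
        intro i
        rw [integral_finsetSum _ (fun j _ =>
          integrable_finsetSum _ fun k _ => integrable_finsetSum _ fun l _ => hint i j k l)]
        have h3 : ∀ j : Fin n, ∫ ω, ∑ k : Fin n, ∑ l : Fin n,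
            ∏ a, Y (auxg μ₁ μ₂ l₁ l₂ i j k l a) ω ∂P = if j = i then 1 else 0 := by
          intro j
          rw [integral_finsetSum _ (fun k _ => integrable_finsetSum _ fun l _ => hint i j k l)]
          have h4 : ∀ k : Fin n, ∫ ω, ∑ l : Fin n,
              ∏ a, Y (auxg μ₁ μ₂ l₁ l₂ i j k l a) ω ∂P
                = if k = i then (if j = i then 1 else 0) else 0 := by
            intro k
            rw [integral_finsetSum _ (fun l _ => hint i j k l)]
            simp_rw [aux_moment P Y hY hindep hG, aux_prod hμ hl]
            by_cases hj : j = i <;> by_cases hk : k = i <;> simp [hj, hk]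
          simp_rw [h4]
          simp
        simp_rw [h3]
        simp
      simp_rw [h2]
      have h5 : (Real.sqrt n) ^ 2 = (n : ℝ) := Real.sq_sqrt (by positivity)
      have h6 : ((Real.sqrt n)⁻¹) ^ 4 = 1 / (n : ℝ) ^ 2 := by
        rw [show (Real.sqrt n)⁻¹ ^ 4 = 1 / ((Real.sqrt n) ^ 2) ^ 2 by ring, h5]
      rw [h6]
      simp
      field_simp
    have hs : ∀ μ₁ μ₂ : Fin m, ∀ l₁ l₂ : Fin p, (if μ₁ ≠ μ₂ ∧ l₁ ≠ l₂ then
          ∫ ω, Z μ₁ l₁ ω * Z μ₁ l₂ ω * Z μ₂ l₂ ω * Z μ₂ l₁ ω ∂P else 0)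
          = (if μ₁ ≠ μ₂ then (1:ℝ) else 0) * (if l₁ ≠ l₂ then 1 / (n : ℝ) else 0) := by
      intro μ₁ μ₂ l₁ l₂
      by_cases h1 : μ₁ ≠ μ₂
      · by_cases h2 : l₁ ≠ l₂
        · rw [if_pos ⟨h1, h2⟩, if_pos h1, if_pos h2, hE _ _ _ _ h1 h2, one_mul]
        · rw [if_neg (fun h => h2 h.2), if_neg h2, mul_zero]
      · rw [if_neg (fun h => h1 h.1), if_neg h1, zero_mul]
    simp_rw [hs, ← Finset.mul_sum, aux_count, ← Finset.sum_mul, aux_count]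
    simp only [Finset.sum_const, Finset.card_univ, Fintype.card_fin, nsmul_eq_mul]
    field_simp
  · intro ms ps α ψ _ _ h1 h2
    have h0 : Tendsto (fun N : ℕ => 1 / (N : ℝ)) atTop (nhds 0) :=
      tendsto_one_div_atTop_nhds_zero_nat
    have h := ((h1.mul (h1.sub h0)).mul h2).mul (h2.sub h0)
    have e : α * (α - 0) * ψ * (ψ - 0) = α ^ 2 * ψ ^ 2 := by ring
    rw [e] at h
    refine h.congr fun N => ?_
    by_cases hN : (N : ℝ) = 0
    · simp [hN]
    · field_simp
end

section
/- Let ε > 0, T > 0, let U ⊆ ℂ be open and g_S : U → ℂ holomorphic. Suppose f : ℝ × (0,T) → ℂ has partial derivatives ∂_t f and ∂_x f, and that for all (x,t) ∈ ℝ × (0,T): (i) x − iε − t f(x,t) ∈ U, (ii) f(x,t) = −g_S(x − iε − t f(x,t)), and (iii) t · g_S′(x − iε − t f(x,t)) ≠ 1. Then f satisfies the complex inviscid Burgers equation: ∂_t f(x,t) + f(x,t) ∂_x f(x,t) = 0 for all (x,t) ∈ ℝ × (0,T). -/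
open Set Complex

/-- **The free-convolution solution satisfies the complex inviscid Burgers equation.**
Let `ε > 0`, `T > 0`, `U ⊆ ℂ` open, `g_S` holomorphic on `U`, and let `f : ℝ × (0,T) → ℂ`
admit partial derivatives `∂_t f` and `∂_x f`.  Assume that for all `(x,t) ∈ ℝ × (0,T)`:
(i) `x − iε − t f(x,t) ∈ U`; (ii) `f(x,t) = −g_S(x − iε − t f(x,t))`;
(iii) `t · g_S′(x − iε − t f(x,t)) ≠ 1`.
Then `∂_t f(x,t) + f(x,t) ∂_x f(x,t) = 0` on `ℝ × (0,T)`. -/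
theorem complex_burgers_of_free_convolution
    (ε T : ℝ) (hε : 0 < ε) (hT : 0 < T)
    (U : Set ℂ) (hU : IsOpen U) (gS : ℂ → ℂ) (hgS : DifferentiableOn ℂ gS U)
    (f ft fx : ℝ → ℝ → ℂ)
    (hft : ∀ (x t : ℝ), t ∈ Ioo 0 T → HasDerivAt (fun s : ℝ => f x s) (ft x t) t)
    (hfx : ∀ (x t : ℝ), t ∈ Ioo 0 T → HasDerivAt (fun y : ℝ => f y t) (fx x t) x)
    (hmem : ∀ (x t : ℝ), t ∈ Ioo 0 T →
      (x : ℂ) - (ε : ℂ) * Complex.I - (t : ℂ) * f x t ∈ U)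
    (heq : ∀ (x t : ℝ), t ∈ Ioo 0 T →
      f x t = -gS ((x : ℂ) - (ε : ℂ) * Complex.I - (t : ℂ) * f x t))
    (hne : ∀ (x t : ℝ), t ∈ Ioo 0 T →
      (t : ℂ) * deriv gS ((x : ℂ) - (ε : ℂ) * Complex.I - (t : ℂ) * f x t) ≠ 1) :
    ∀ (x t : ℝ), t ∈ Ioo 0 T → ft x t + f x t * fx x t = 0 := by
  intro x t ht
  have hg := (hgS.differentiableAt (hU.mem_nhds (hmem x t ht))).hasDerivAt
  have hn := hne x t ht
  have hzt : HasDerivAt (fun s : ℝ => (x : ℂ) - (ε : ℂ) * Complex.I - (s : ℂ) * f x s)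
      (-(1 * f x t + (t : ℂ) * ft x t)) t :=
    ((Complex.ofRealCLM.hasDerivAt (x := t)).mul (hft x t ht)).const_sub _
  have hzx : HasDerivAt (fun y : ℝ => (y : ℂ) - (ε : ℂ) * Complex.I - (t : ℂ) * f y t)
      (1 - (t : ℂ) * fx x t) x :=
    ((Complex.ofRealCLM.hasDerivAt (x := x)).sub_const _).sub ((hfx x t ht).const_mul _)
  have h1 := (HasDerivAt.scomp t hg hzt).neg
  have h2 := (HasDerivAt.scomp x hg hzx).neg
  have e1 := (hft x t ht).unique (h1.congr_of_eventuallyEq (by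
    filter_upwards [isOpen_Ioo.mem_nhds ht] with s hs
    exact heq x s hs))
  have e2 := (hfx x t ht).unique (h2.congr_of_eventuallyEq
    (Filter.Eventually.of_forall fun y => heq y t ht))
  simp only [smul_eq_mul] at e1 e2
  generalize deriv gS _ = G at *
  have hn' : 1 - (t : ℂ) * G ≠ 0 := sub_ne_zero.mpr (Ne.symm hn)
  refine (mul_eq_zero.mp (?_ : (1 - (t : ℂ) * G) * _ = 0)).resolve_left hn'
  linear_combination e1 + f x t * e2
end
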